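/- arXiv:math/0408399 — 2 statements merged into one kernel-verified Lean document; each statement's English description precedes it below -/
import Mathlib

section
/- Let R be a normal domain and let S = R[X_1,...,X_n] be a polynomial ring over R. Then base change along the inclusion R → S induces a bijection on isomorphism classes of semidualizing modules: for every semidualizing R-module C, the S-module C ⊗_R S is semidualizing; every semidualizing S-module is isomorphic to C ⊗_R S for some semidualizing R-module C; and if C ⊗_R S ≅ C' ⊗_R S for semidualizing R-modules C, C', then C ≅ C'. -/
open CategoryTheory

/-- The `i`-th Ext module of two `R`-modules, over a commutative ring `R`. -/
noncomputable def ExtModule (R : Type) [CommRing R] (M N : ModuleCat.{0} R) (i : ℕ) :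
    ModuleCat R :=
  ((Ext R (ModuleCat.{0} R) i).obj (Opposite.op M)).obj N

/-- `C` is a semidualizing `R`-module: it is finitely generated, the homothety map
`R → Hom_R(C,C)` is bijective, and `Ext^i_R(C,C) = 0` for all `i > 0`. -/
def IsSemidualizing (R : Type) [CommRing R] (C : Type) [AddCommGroup C] [Module R C] : Prop :=
  Module.Finite R C ∧
  Function.Bijective (algebraMap R (Module.End R C)) ∧
  ∀ i : ℕ, 0 < i → Subsingleton (ExtModule R (ModuleCat.of R C) (ModuleCat.of R C) i)

/-- `M` has finite injective dimension over `R`: `Ext^i_R(-, M)` vanishes uniformly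
for all large `i`. -/
def HasFiniteInjectiveDimension (R : Type) [CommRing R] (M : Type) [AddCommGroup M]
    [Module R M] : Prop :=
  ∃ n : ℕ, ∀ (N : ModuleCat.{0} R) (i : ℕ), n < i →
    Subsingleton (ExtModule R N (ModuleCat.of R M) i)

/-- A Gorenstein local ring: a commutative Noetherian local ring having finite injective
dimension as a module over itself. -/
def IsGorensteinLocalRing (R : Type) [CommRing R] : Prop :=
  IsNoetherianRing R ∧ IsLocalRing R ∧ HasFiniteInjectiveDimension R R

/-- The length of an `R`-module, i.e. the Krull dimension of its lattice of submodules. -/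
noncomputable def moduleLength (R M : Type) [CommRing R] [AddCommGroup M] [Module R M] :
    WithBot ℕ∞ :=
  Order.krullDim (Submodule R M)

/-- Vanishing of the derived functor `ExtModule` in positive degree is vanishing of `Abelian.Ext`. -/
lemma subsingleton_extModule_iff (R : Type) [CommRing R] (M N : ModuleCat.{0} R) (n : ℕ) :
    Subsingleton (ExtModule R M N (n + 1)) ↔ Subsingleton (Abelian.Ext M N (n + 1)) := by
  let P := ProjectiveResolution.of M
  have h₁ : Subsingleton (ExtModule R M N (n + 1)) ↔
      ∀ f : P.complex.X (n + 1) ⟶ N, P.complex.d (n + 2) (n + 1) ≫ f = 0 →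
        ∃ g : P.complex.X n ⟶ N, P.complex.d (n + 1) n ≫ g = f := by
    rw [← ModuleCat.isZero_iff_subsingleton, ExtModule,
      (P.isoExt (R := R) (n + 1) N).isZero_iff, ← HomologicalComplex.exactAt_iff_isZero_homology,
      HomologicalComplex.exactAt_iff' _ n (n + 1) (n + 2) (by simp) (by simp),
      ShortComplex.moduleCat_exact_iff]
    rfl
  rw [h₁]
  constructor
  · intro h
    refine subsingleton_of_forall_eq 0 fun α ↦ ?_
    obtain ⟨f, hf, rfl⟩ := P.extMk_surjective α (n + 2) rfl
    exact (P.extMk_eq_zero_iff f _ rfl hf n rfl).2 (h f hf)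
  · intro h f hf
    exact (P.extMk_eq_zero_iff f _ rfl hf n rfl).1 (Subsingleton.elim _ _)

section

variable {R : Type} [CommRing R] {K F M : Type} [AddCommGroup K] [AddCommGroup F] [AddCommGroup M]
  [Module R K] [Module R F] [Module R M] [Module.Projective R F]
  {f : K →ₗ[R] F} {g : F →ₗ[R] M}

lemma subsingleton_extModule_one_iff (hf : Function.Injective f) (hg : Function.Surjective g)
    (hfg : Function.Exact f g) (N : Type) [AddCommGroup N] [Module R N] :
    Subsingleton (ExtModule R (ModuleCat.of R M) (ModuleCat.of R N) 1) ↔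
      Function.Surjective (f.lcomp R N) := by
  let S : ShortComplex (ModuleCat.{0} R) :=
    ModuleCat.shortComplexOfCompEqZero f g hfg.linearMap_comp_eq_zero
  have hS : S.ShortExact := ModuleCat.shortComplex_shortExact S hfg hf hg
  have : Projective S.X₂ := inferInstanceAs (Projective (ModuleCat.of R F))
  rw [subsingleton_extModule_iff]
  constructor
  · intro h φ
    obtain ⟨x, hx⟩ := Abelian.Ext.contravariant_sequence_exact₁ hS (ModuleCat.of R N)
      (Abelian.Ext.mk₀ (ModuleCat.ofHom φ)) (n₁ := 1) rfl
      (Subsingleton.elim (α := Abelian.Ext (ModuleCat.of R M) (ModuleCat.of R N) 1) _ _)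
    obtain ⟨ψ, rfl⟩ := (Abelian.Ext.mk₀_bijective _ _).2 x
    rw [Abelian.Ext.mk₀_comp_mk₀] at hx
    exact ⟨ψ.hom, congrArg ModuleCat.Hom.hom ((Abelian.Ext.mk₀_bijective _ _).1 hx)⟩
  · intro h
    refine subsingleton_of_forall_eq 0 fun α ↦ ?_
    obtain ⟨x, rfl⟩ := Abelian.Ext.contravariant_sequence_exact₃ hS _ α
      (Abelian.Ext.eq_zero_of_projective (P := S.X₂) _) (n₀ := 0) rfl
    obtain ⟨φ, rfl⟩ := (Abelian.Ext.mk₀_bijective _ _).2 x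
    obtain ⟨ψ, hψ⟩ := h φ.hom
    have : φ = S.f ≫ ModuleCat.ofHom ψ := ModuleCat.hom_ext hψ.symm
    rw [this, ← Abelian.Ext.mk₀_comp_mk₀, ← Abelian.Ext.comp_assoc_of_second_deg_zero,
      hS.extClass_comp, Abelian.Ext.zero_comp]

lemma subsingleton_extModule_succ_iff (hf : Function.Injective f) (hg : Function.Surjective g)
    (hfg : Function.Exact f g) (N : Type) [AddCommGroup N] [Module R N] (n : ℕ) :
    Subsingleton (ExtModule R (ModuleCat.of R M) (ModuleCat.of R N) (n + 2)) ↔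
      Subsingleton (ExtModule R (ModuleCat.of R K) (ModuleCat.of R N) (n + 1)) := by
  let S : ShortComplex (ModuleCat.{0} R) :=
    ModuleCat.shortComplexOfCompEqZero f g hfg.linearMap_comp_eq_zero
  have hS : S.ShortExact := ModuleCat.shortComplex_shortExact S hfg hf hg
  have : Projective S.X₂ := inferInstanceAs (Projective (ModuleCat.of R F))
  rw [subsingleton_extModule_iff, subsingleton_extModule_iff]
  constructor
  · intro h
    refine subsingleton_of_forall_eq 0 fun α ↦ ?_
    obtain ⟨x, rfl⟩ := Abelian.Ext.contravariant_sequence_exact₁ hS (ModuleCat.of R N)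
      α (n₁ := n + 2) (by lia)
      (Subsingleton.elim (α := Abelian.Ext (ModuleCat.of R M) (ModuleCat.of R N) (n + 2)) _ _)
    rw [Abelian.Ext.eq_zero_of_projective (P := S.X₂) x, Abelian.Ext.comp_zero]
  · intro h
    refine subsingleton_of_forall_eq 0 fun α ↦ ?_
    obtain ⟨x, rfl⟩ := Abelian.Ext.contravariant_sequence_exact₃ hS _ α
      (Abelian.Ext.eq_zero_of_projective (P := S.X₂) _) (n₀ := n + 1) (by lia)
    rw [Subsingleton.elim (α := Abelian.Ext (ModuleCat.of R K) (ModuleCat.of R N) (n + 1)) x 0,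
      Abelian.Ext.comp_zero]

end

section BaseChange

open TensorProduct

variable {R : Type} [CommRing R] (S : Type) [CommRing S] [Algebra R S] [Module.FaithfullyFlat R S]

lemma surjective_lcomp_baseChange_iff {K F : Type} [AddCommGroup K] [AddCommGroup F]
    [Module R K] [Module R F] [Module.FinitePresentation R K] [Module.FinitePresentation R F]
    (f : K →ₗ[R] F) (N : Type) [AddCommGroup N] [Module R N] :
    Function.Surjective ((f.baseChange S).lcomp S (S ⊗[R] N)) ↔
      Function.Surjective (f.lcomp R N) := by
  let eF := (Module.FinitePresentation.isBaseChange_map R F N S).equiv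
  let eK := (Module.FinitePresentation.isBaseChange_map R K N S).equiv
  have h : (f.baseChange S).lcomp S (S ⊗[R] N) ∘ₗ eF.toLinearMap =
      eK.toLinearMap ∘ₗ (f.lcomp R N).baseChange S := by
    refine TensorProduct.AlgebraTensorModule.curry_injective (LinearMap.ext fun s ↦
      LinearMap.ext fun φ ↦ ?_)
    refine TensorProduct.AlgebraTensorModule.curry_injective (LinearMap.ext fun t ↦
      LinearMap.ext fun x ↦ ?_)
    simp [eF, eK, IsBaseChange.equiv_tmul]
  rw [← Module.FaithfullyFlat.lTensor_surjective_iff_surjective R S (f.lcomp R N),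
    ← eF.surjective.of_comp_iff ((f.baseChange S).lcomp S (S ⊗[R] N)),
    ← EquivLike.comp_surjective _ eK]
  exact iff_of_eq (congrArg Function.Surjective (congrArg DFunLike.coe h))

lemma bijective_algebraMap_end_baseChange_iff (M : Type) [AddCommGroup M] [Module R M]
    [Module.FinitePresentation R M] :
    Function.Bijective (algebraMap S (Module.End S (S ⊗[R] M))) ↔
      Function.Bijective (algebraMap R (Module.End R M)) := by
  let e := (Module.FinitePresentation.isBaseChange_map R M M S).equiv
  have h : Algebra.linearMap S (Module.End S (S ⊗[R] M)) ∘ₗ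
      (AlgebraTensorModule.rid R S S).toLinearMap =
      e.toLinearMap ∘ₗ (Algebra.linearMap R (Module.End R M)).baseChange S := by
    refine TensorProduct.AlgebraTensorModule.curry_injective (LinearMap.ext fun s ↦
      LinearMap.ext fun r ↦ ?_)
    refine TensorProduct.AlgebraTensorModule.curry_injective (LinearMap.ext fun t ↦
      LinearMap.ext fun x ↦ ?_)
    simp [e, IsBaseChange.equiv_tmul, Algebra.algebraMap_eq_smul_one, smul_tmul']
  have h' := congrArg Function.Bijective (congrArg DFunLike.coe h)
  change Function.Bijective (Algebra.linearMap S (Module.End S (S ⊗[R] M))) ↔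
    Function.Bijective (Algebra.linearMap R (Module.End R M))
  rw [← Module.FaithfullyFlat.lTensor_bijective_iff_bijective R S,
    ← Function.Bijective.of_comp_iff _ (AlgebraTensorModule.rid R S S).bijective,
    ← Function.Bijective.of_comp_iff' e.bijective]
  exact iff_of_eq h'

lemma subsingleton_extModule_baseChange_iff [IsNoetherianRing R] (N : Type) [AddCommGroup N]
    [Module R N] (n : ℕ) : ∀ (M : Type) [AddCommGroup M] [Module R M] [Module.Finite R M],
    Subsingleton (ExtModule S (ModuleCat.of S (S ⊗[R] M)) (ModuleCat.of S (S ⊗[R] N)) (n + 1)) ↔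
      Subsingleton (ExtModule R (ModuleCat.of R M) (ModuleCat.of R N) (n + 1)) := by
  induction n with
  | zero =>
    intro M _ _ _
    obtain ⟨k, g, hg⟩ := Module.Finite.exists_fin' R M
    have hf : Function.Injective (LinearMap.ker g).subtype := Subtype.val_injective
    have hfg : Function.Exact (LinearMap.ker g).subtype g := LinearMap.exact_subtype_ker_map g
    rw [zero_add, subsingleton_extModule_one_iff hf hg hfg,
      subsingleton_extModule_one_iff (f := (LinearMap.ker g).subtype.baseChange S)
        (g := g.baseChange S)
        (Module.Flat.lTensor_preserves_injective_linearMap _ hf) (LinearMap.lTensor_surjective S hg)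
        (lTensor_exact S hfg hg)]
    have := Module.finitePresentation_of_finite R (LinearMap.ker g)
    exact surjective_lcomp_baseChange_iff S _ N
  | succ n ih =>
    intro M _ _ _
    obtain ⟨k, g, hg⟩ := Module.Finite.exists_fin' R M
    have hf : Function.Injective (LinearMap.ker g).subtype := Subtype.val_injective
    have hfg : Function.Exact (LinearMap.ker g).subtype g := LinearMap.exact_subtype_ker_map g
    rw [subsingleton_extModule_succ_iff hf hg hfg,
      subsingleton_extModule_succ_iff (f := (LinearMap.ker g).subtype.baseChange S)
        (g := g.baseChange S)
        (Module.Flat.lTensor_preserves_injective_linearMap _ hf) (LinearMap.lTensor_surjective S hg)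
        (lTensor_exact S hfg hg)]
    exact ih _

/-- Being semidualizing ascends and descends along faithfully flat extensions. -/
theorem isSemidualizing_baseChange_iff [IsNoetherianRing R] (C : Type) [AddCommGroup C]
    [Module R C] : IsSemidualizing S (S ⊗[R] C) ↔ IsSemidualizing R C := by
  have hfin : Module.Finite S (S ⊗[R] C) ↔ Module.Finite R C :=
    ⟨fun _ ↦ .of_finite_tensorProduct_of_faithfullyFlat S, fun _ ↦ inferInstance⟩
  unfold IsSemidualizing
  rw [hfin]
  refine and_congr_right fun _ ↦ ?_
  have := Module.finitePresentation_of_finite R C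
  rw [bijective_algebraMap_end_baseChange_iff]
  refine and_congr_right fun _ ↦ forall_congr' fun i ↦ ?_
  cases i with
  | zero => simp
  | succ n => simp [subsingleton_extModule_baseChange_iff S C n C]

end BaseChange

section HomToQuotient

open TensorProduct

variable {S : Type*} [CommRing S]

/-- A finitely generated faithful module maps nontrivially to `S ⧸ P` for every prime `P`. -/
lemma exists_ne_zero_hom_quotient_prime {M : Type*} [AddCommGroup M] [Module S M]
    [Module.Finite S M] (hM : Module.annihilator S M = ⊥) (P : Ideal S) [P.IsPrime] :
    ∃ φ : M →ₗ[S] S ⧸ P, φ ≠ 0 := by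
  classical
  let k := P.ResidueField
  have hnt : Nontrivial (k ⊗[S] M) :=
    (Module.mem_support_iff_nontrivial_residueField_tensorProduct ⟨P, ‹_›⟩).1
      (Module.mem_support_iff_of_finite.2 (hM.trans_le bot_le))
  obtain ⟨v, hv⟩ := exists_ne (0 : k ⊗[S] M)
  obtain ⟨l, hl⟩ := not_forall.1 (mt (Module.forall_dual_apply_eq_zero_iff k v).1 hv)
  let ψ : M →ₗ[S] k := l.restrictScalars S ∘ₗ TensorProduct.mk S k M 1
  have hψ : ψ ≠ 0 := by
    rintro h
    refine hl ?_
    have : l = 0 := by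
      refine TensorProduct.AlgebraTensorModule.curry_injective (LinearMap.ext fun s ↦
        LinearMap.ext fun x ↦ ?_)
      have hx : l (1 ⊗ₜ x) = 0 := LinearMap.congr_fun h x
      have : s ⊗ₜ[S] x = s • (1 ⊗ₜ[S] x) := by simp [smul_tmul']
      simp [this, hx]
    simp [this]
  obtain ⟨s, hs⟩ := Module.Finite.fg_top (R := S) (M := M)
  obtain ⟨b, hb⟩ := IsLocalization.exist_integer_multiples_of_finset (nonZeroDivisors (S ⧸ P))
    (s.image ψ)
  let j : (S ⧸ P) →ₗ[S] k := (Algebra.linearMap (S ⧸ P) k).restrictScalars S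
  have hj : Function.Injective j := P.injective_algebraMap_quotient_residueField
  let ψ' : M →ₗ[S] k := (b : S ⧸ P) • ψ
  have hrange : LinearMap.range ψ' ≤ LinearMap.range j := by
    rw [LinearMap.range_eq_map, ← hs, Submodule.map_span_le]
    intro m hm
    obtain ⟨a, ha⟩ := hb (ψ m) (Finset.mem_image_of_mem _ hm)
    exact ⟨a, ha⟩
  let e := LinearEquiv.ofInjective j hj
  refine ⟨e.symm.toLinearMap ∘ₗ ψ'.codRestrict (LinearMap.range j) fun m ↦ hrange ⟨m, rfl⟩, ?_⟩
  intro h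
  apply hψ
  ext m
  have h₁ : e.symm ⟨ψ' m, hrange ⟨m, rfl⟩⟩ = 0 := LinearMap.congr_fun h m
  rw [LinearEquiv.map_eq_zero_iff, Subtype.ext_iff] at h₁
  have h₂ : (b : S ⧸ P) • ψ m = 0 := h₁
  rw [Algebra.smul_def] at h₂
  refine (mul_eq_zero.1 h₂).resolve_left fun h₃ ↦ nonZeroDivisors.coe_ne_zero b ?_
  exact hj (h₃.trans (map_zero _).symm)

/-- A finitely generated faithful module `M` admits a nonzero map to any nonzero module `N`
killed by a prime containing the annihilator of a given nonzero element of `N`. -/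
lemma exists_ne_zero_hom_of_ne_zero [IsNoetherianRing S] {M N : Type*} [AddCommGroup M]
    [Module S M] [Module.Finite S M] [AddCommGroup N] [Module S N]
    (hM : Module.annihilator S M = ⊥) {x : N} (hx : x ≠ 0) :
    ∃ (P : Ideal S) (χ : M →ₗ[S] N), (∀ s : S, s • x = 0 → s ∈ P) ∧ χ ≠ 0 ∧
      ∀ s ∈ P, s • χ = 0 := by
  obtain ⟨P, hP, hle⟩ := exists_le_isAssociatedPrime_of_isNoetherianRing S x hx
  obtain ⟨hprime, y, hy⟩ := isAssociatedPrime_iff.1 hP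
  obtain ⟨φ, hφ⟩ := exists_ne_zero_hom_quotient_prime hM P
  have hmem : ∀ s : S, s ∈ P ↔ s • y = 0 := fun s ↦ by
    rw [hy, Submodule.mem_colon_singleton, Submodule.mem_bot]
  have hker : LinearMap.ker (LinearMap.toSpanSingleton S N y) = P := by
    ext s
    simp [hmem]
  let ι : (S ⧸ P) →ₗ[S] N := Submodule.liftQ P (LinearMap.toSpanSingleton S N y) hker.ge
  have hι : Function.Injective ι := LinearMap.ker_eq_bot.1 (by
    rw [Submodule.ker_liftQ, hker, Submodule.mkQ_map_self])
  refine ⟨P, ι ∘ₗ φ, fun s hs ↦ hle ?_, fun h ↦ hφ ?_, fun s hs ↦ ?_⟩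
  · rwa [Submodule.mem_colon_singleton, Submodule.mem_bot]
  · ext m
    exact hι ((LinearMap.congr_fun h m).trans (map_zero ι).symm)
  · ext m
    obtain ⟨a, ha⟩ := Ideal.Quotient.mk_surjective (φ m)
    have : ι (φ m) = a • y := by rw [← ha]; rfl
    simp [this, smul_comm s a y, (hmem s).1 hs]

end HomToQuotient

/-- If `Ext¹(M, N) = 0`, maps from `M` to `N ⧸ x N` lift to `N` when `x` is regular on `N`. -/
lemma exists_lift_of_subsingleton_extModule {S : Type} [CommRing S] {M N : Type}
    [AddCommGroup M] [Module S M] [AddCommGroup N] [Module S N]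
    (h : Subsingleton (ExtModule S (ModuleCat.of S M) (ModuleCat.of S N) 1)) {x : S}
    (hx : Function.Injective (LinearMap.lsmul S N x))
    (φ : M →ₗ[S] N ⧸ LinearMap.range (LinearMap.lsmul S N x)) :
    ∃ ψ : M →ₗ[S] N, (LinearMap.range (LinearMap.lsmul S N x)).mkQ ∘ₗ ψ = φ := by
  have hexact : Function.Exact (LinearMap.lsmul S N x)
      (LinearMap.range (LinearMap.lsmul S N x)).mkQ := LinearMap.exact_map_mkQ_range _
  let T : ShortComplex (ModuleCat.{0} S) :=
    ModuleCat.shortComplexOfCompEqZero _ _ hexact.linearMap_comp_eq_zero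
  have hT : T.ShortExact :=
    ModuleCat.shortComplex_shortExact T hexact hx (Submodule.mkQ_surjective _)
  rw [subsingleton_extModule_iff] at h
  obtain ⟨y, hy⟩ := Abelian.Ext.covariant_sequence_exact₃ (ModuleCat.of S M) hT
    (Abelian.Ext.mk₀ (ModuleCat.ofHom φ)) (n₁ := 1) rfl
    (Subsingleton.elim (α := Abelian.Ext (ModuleCat.of S M) (ModuleCat.of S N) 1) _ _)
  obtain ⟨ψ, rfl⟩ := (Abelian.Ext.mk₀_bijective _ _).2 y
  rw [Abelian.Ext.mk₀_comp_mk₀] at hy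
  exact ⟨ψ.hom, congrArg ModuleCat.Hom.hom ((Abelian.Ext.mk₀_bijective _ _).1 hy)⟩

/-- Being semidualizing is invariant under isomorphism. -/
lemma IsSemidualizing.of_equiv {S : Type} [CommRing S] {C D : Type} [AddCommGroup C] [Module S C]
    [AddCommGroup D] [Module S D] (e : C ≃ₗ[S] D) (h : IsSemidualizing S C) :
    IsSemidualizing S D := by
  obtain ⟨hfin, hbij, hext⟩ := h
  refine ⟨.equiv e, ?_, fun i hi ↦ ?_⟩
  · have : (algebraMap S (Module.End S D) : S → Module.End S D) =
        e.conj ∘ algebraMap S (Module.End S C) := by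
      ext s d
      simp [LinearEquiv.conj_apply]
    rw [this]
    exact e.conj.bijective.comp hbij
  · have := hext i hi
    let i₁ : ((Ext S (ModuleCat.{0} S) i).obj (Opposite.op (ModuleCat.of S C))) ≅
        ((Ext S (ModuleCat.{0} S) i).obj (Opposite.op (ModuleCat.of S D))) :=
      (Ext S (ModuleCat.{0} S) i).mapIso e.toModuleIso.symm.op
    let i₂ : ExtModule S (ModuleCat.of S C) (ModuleCat.of S C) i ≅
        ExtModule S (ModuleCat.of S D) (ModuleCat.of S D) i :=
      i₁.app _ ≪≫ ((Ext S (ModuleCat.{0} S) i).obj _).mapIso e.toModuleIso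
    exact i₂.toLinearEquiv.symm.toEquiv.subsingleton

lemma IsSemidualizing.annihilator_eq_bot {S : Type} [CommRing S] {D : Type} [AddCommGroup D]
    [Module S D] (h : IsSemidualizing S D) : Module.annihilator S D = ⊥ := by
  refine eq_bot_iff.2 fun s hs ↦ h.2.1.1 ?_
  ext d
  simpa using Module.mem_annihilator.1 hs d

lemma IsSemidualizing.exists_eq_smul {S : Type} [CommRing S] {D : Type} [AddCommGroup D]
    [Module S D] (h : IsSemidualizing S D) (φ : D →ₗ[S] D) : ∃ s : S, ∀ d, φ d = s • d := by
  obtain ⟨s, rfl⟩ := h.2.1.2 φ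
  exact ⟨s, fun d ↦ rfl⟩

section Domain

variable {S : Type} [CommRing S] [IsDomain S] [IsNoetherianRing S] {D : Type} [AddCommGroup D]
  [Module S D]

/-- A semidualizing module over a Noetherian domain is torsion-free. -/
lemma IsSemidualizing.eq_zero_or_eq_zero (h : IsSemidualizing S D) {s : S} {d : D}
    (hsd : s • d = 0) : s = 0 ∨ d = 0 := by
  refine or_iff_not_imp_right.2 fun hd ↦ ?_
  have := h.1
  obtain ⟨P, χ, hP, hχ, hPχ⟩ := exists_ne_zero_hom_of_ne_zero h.annihilator_eq_bot hd
  obtain ⟨t, ht⟩ := h.exists_eq_smul χ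
  have hst : s * t = 0 := by
    rw [← Ideal.mem_bot, ← h.annihilator_eq_bot, Module.mem_annihilator]
    intro x
    rw [mul_smul, ← ht]
    exact LinearMap.congr_fun (hPχ s (hP s hsd)) x
  refine (mul_eq_zero.1 hst).resolve_right fun h0 ↦ hχ ?_
  ext x
  simp [ht, h0]

/-- A semidualizing module over a Noetherian domain is isomorphic to a nonzero ideal. -/
lemma IsSemidualizing.exists_ideal_equiv (h : IsSemidualizing S D) :
    ∃ I : Ideal S, I ≠ ⊥ ∧ Nonempty (D ≃ₗ[S] I) := by
  have := h.1
  obtain ⟨φ₀, hφ₀⟩ := exists_ne_zero_hom_quotient_prime h.annihilator_eq_bot (⊥ : Ideal S)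
  let φ : D →ₗ[S] S := (Submodule.quotEquivOfEqBot (⊥ : Ideal S) rfl).toLinearMap ∘ₗ φ₀
  have hφ : φ ≠ 0 := fun h0 ↦ hφ₀ <| by
    ext d
    simpa [φ] using LinearMap.congr_fun h0 d
  obtain ⟨e, he⟩ : ∃ e, φ e ≠ 0 := by
    by_contra! h0
    exact hφ (LinearMap.ext h0)
  obtain ⟨s, hs⟩ := h.exists_eq_smul (φ.smulRight e)
  have hinj : Function.Injective φ := by
    rw [injective_iff_map_eq_zero]
    intro x hx
    have hs0 : s ≠ 0 := by
      rintro rfl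
      have := hs e
      simp only [LinearMap.smulRight_apply, zero_smul] at this
      rcases h.eq_zero_or_eq_zero this with h0 | h0
      · exact he h0
      · exact he (by simp [h0])
    have := hs x
    simp only [LinearMap.smulRight_apply, hx, zero_smul] at this
    exact (h.eq_zero_or_eq_zero this.symm).resolve_left hs0
  exact ⟨LinearMap.range φ, fun h0 ↦ hφ (LinearMap.range_eq_bot.1 h0),
    ⟨LinearEquiv.ofInjective φ hinj⟩⟩

/-- A semidualizing ideal of a Noetherian normal domain is divisorial. -/
lemma IsSemidualizing.exists_mem_of_forall [IsIntegrallyClosed S] {I : Ideal S} (hI : I ≠ ⊥)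
    (h : IsSemidualizing S I) {L : Type} [Field L] [Algebra S L] [IsFractionRing S L] {z : L}
    (hz : ∀ y : L, (∀ i ∈ I, IsLocalization.IsInteger S (y * algebraMap S L i)) →
      IsLocalization.IsInteger S (y * z)) :
    ∃ i ∈ I, algebraMap S L i = z := by
  have hfin := h.1
  have hinjL : Function.Injective (algebraMap S L) := IsFractionRing.injective S L
  obtain ⟨i₀, hi₀, hi₀'⟩ := Submodule.exists_mem_ne_zero_of_ne_bot hI
  obtain ⟨a, b, hb, hab⟩ := IsFractionRing.div_surjective (A := S) z
  have hb0 : b ≠ 0 := nonZeroDivisors.ne_zero hb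
  have hbL : algebraMap S L b ≠ 0 := (map_ne_zero_iff _ hinjL).2 hb0
  set x : S := b * i₀ with hxdef
  have hx0 : x ≠ 0 := mul_ne_zero hb0 hi₀'
  have hxL : algebraMap S L x ≠ 0 := (map_ne_zero_iff _ hinjL).2 hx0
  let w : I := ⟨a * i₀, I.mul_mem_left a hi₀⟩
  have hwz : algebraMap S L (a * i₀) = algebraMap S L x * z := by
    rw [← hab, hxdef, map_mul, map_mul]
    field_simp
  clear_value x
  have hxinj : Function.Injective (LinearMap.lsmul S I x) := by
    rw [injective_iff_map_eq_zero]
    intro i hi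
    exact (h.eq_zero_or_eq_zero hi).resolve_left hx0
  set N := LinearMap.range (LinearMap.lsmul S I x) with hN
  by_contra hcon
  have hw : N.mkQ w ≠ 0 := by
    intro h0
    rw [Submodule.mkQ_apply, Submodule.Quotient.mk_eq_zero] at h0
    obtain ⟨i, hi⟩ := h0
    refine hcon ⟨i, i.2, mul_left_cancel₀ hxL ?_⟩
    rw [← hwz, ← map_mul]
    exact congrArg (algebraMap S L) (Subtype.ext_iff.1 hi)
  obtain ⟨P, χ, hP, hχ, hPχ⟩ := exists_ne_zero_hom_of_ne_zero h.annihilator_eq_bot hw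
  obtain ⟨ψ, hψ⟩ := exists_lift_of_subsingleton_extModule (h.2.2 1 one_pos) hxinj χ
  obtain ⟨y, hy⟩ := h.exists_eq_smul ψ
  have hxy : ¬ x ∣ y := by
    rintro ⟨c, rfl⟩
    refine hχ (hψ ▸ LinearMap.ext fun i ↦ ?_)
    rw [LinearMap.comp_apply, hy, Submodule.mkQ_apply, LinearMap.zero_apply,
      Submodule.Quotient.mk_eq_zero]
    exact ⟨c • i, (mul_smul x c i).symm⟩
  have hPy : ∀ s ∈ P, x ∣ s * y := by
    intro s hs
    have hmem : ∀ i : I, ((s * y) • LinearMap.id (R := S) (M := I)) i ∈ N := by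
      intro i
      have := LinearMap.congr_fun (hPχ s hs) i
      rw [← hψ, LinearMap.smul_apply, LinearMap.comp_apply, hy, ← map_smul, Submodule.mkQ_apply,
        LinearMap.zero_apply, Submodule.Quotient.mk_eq_zero] at this
      rwa [LinearMap.smul_apply, LinearMap.id_apply, mul_smul]
    let θ : I →ₗ[S] I := (LinearEquiv.ofInjective _ hxinj).symm.toLinearMap ∘ₗ
      LinearMap.codRestrict N _ hmem
    obtain ⟨c, hc⟩ := h.exists_eq_smul θ
    refine ⟨c, ?_⟩
    have h₁ := congrArg (fun v ↦ ((LinearEquiv.ofInjective _ hxinj v : N) : I)) (hc ⟨i₀, hi₀⟩)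
    simp only [θ, LinearMap.comp_apply, LinearEquiv.coe_coe, LinearEquiv.apply_symm_apply] at h₁
    have h₂ : s * y * i₀ = x * (c * i₀) := congrArg Subtype.val h₁
    exact mul_right_cancel₀ hi₀' (h₂.trans (mul_assoc x c i₀).symm)
  let J : Submodule S L :=
    { carrier := {u | ∀ i ∈ I, IsLocalization.IsInteger S (u * algebraMap S L i)}
      add_mem' := fun hu hv i hi ↦ by
        rw [add_mul]
        exact IsLocalization.isInteger_add (hu i hi) (hv i hi)
      zero_mem' := fun i _ ↦ by
        rw [zero_mul]
        exact ⟨0, map_zero _⟩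
      smul_mem' := fun s u hu i hi ↦ by
        rw [smul_mul_assoc]
        exact IsLocalization.isInteger_smul (hu i hi) }
  have hJ1 : (1 : L) ∈ J := fun i _ ↦ ⟨i, by simp⟩
  have hJfg : J.FG := by
    let m : J →ₗ[S] L := (LinearMap.mulRight S (algebraMap S L i₀)) ∘ₗ J.subtype
    let l : S →ₗ[S] L := Algebra.linearMap S L
    have hm : ∀ u, m u ∈ LinearMap.range l := fun u ↦ u.2 i₀ hi₀
    have : IsNoetherian S J := by
      refine isNoetherian_of_injective ((LinearEquiv.ofInjective l hinjL).symm.toLinearMap ∘ₗ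
        m.codRestrict (LinearMap.range l) hm) ?_
      refine (LinearEquiv.ofInjective l hinjL).symm.injective.comp fun u v huv ↦ Subtype.ext ?_
      exact mul_right_cancel₀ ((map_ne_zero_iff _ hinjL).2 hi₀') (Subtype.ext_iff.1 huv)
    exact (Submodule.fg_top J).1 (IsNoetherian.noetherian ⊤)
  let t : L := algebraMap S L y / algebraMap S L x
  have ht : IsIntegral S t := by
    refine isIntegral_of_smul_mem_submodule J (fun h0 ↦ ?_) hJfg t fun u hu i hi ↦ ?_
    · rw [h0] at hJ1
      exact one_ne_zero hJ1
    · obtain ⟨s, hs⟩ := hu i hi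
      obtain ⟨r, hr⟩ := hz u hu
      have hsP : s ∈ P := by
        refine hP s ?_
        rw [← map_smul, Submodule.mkQ_apply, Submodule.Quotient.mk_eq_zero]
        refine ⟨⟨r * i, I.mul_mem_left r hi⟩, Subtype.ext (hinjL ?_)⟩
        change algebraMap S L (x * (r * i)) = algebraMap S L (s * (a * i₀))
        rw [map_mul _ x, map_mul _ r, map_mul _ s, hr, hwz, hs]
        ring
      obtain ⟨c, hc⟩ := hPy s hsP
      refine ⟨c, ?_⟩
      rw [smul_eq_mul, mul_assoc, ← hs, div_mul_eq_mul_div, eq_div_iff hxL, ← map_mul, ← map_mul,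
        mul_comm y s, hc, mul_comm]
  obtain ⟨c, hc⟩ := IsIntegrallyClosed.isIntegral_iff.1 ht
  refine hxy ⟨c, hinjL ?_⟩
  rw [map_mul, hc, mul_div_cancel₀ _ hxL]

end Domain

/-- A polynomial ring over a normal domain is integrally closed. -/
lemma isIntegrallyClosed_mvPolynomial_fin (R : Type*) [CommRing R] [IsDomain R]
    [IsIntegrallyClosed R] (n : ℕ) : IsIntegrallyClosed (MvPolynomial (Fin n) R) := by
  induction n with
  | zero => exact .of_equiv (MvPolynomial.isEmptyAlgEquiv R (Fin 0)).symm.toRingEquiv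
  | succ n ih => exact .of_equiv (MvPolynomial.finSuccEquiv R n).symm.toRingEquiv

/-- A nonzero polynomial over the fraction field of a valuation ring is a nonzero scalar multiple
of a polynomial over the valuation ring with nonzero residue. -/
lemma ValuationSubring.exists_primitive {K σ : Type*} [Field K] (V : ValuationSubring K)
    {f : MvPolynomial σ K} (hf : f ≠ 0) :
    ∃ (a : K) (F : MvPolynomial σ V), a ≠ 0 ∧
      f = MvPolynomial.C a * MvPolynomial.map (algebraMap V K) F ∧
      MvPolynomial.map (IsLocalRing.residue V) F ≠ 0 := by
  obtain ⟨m, hm, hmax⟩ := f.support.exists_max_image (fun m ↦ V.valuation (f.coeff m))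
    (MvPolynomial.support_nonempty.2 hf)
  have ha : f.coeff m ≠ 0 := MvPolynomial.mem_support_iff.1 hm
  have hmem (j) : (MvPolynomial.C (f.coeff m)⁻¹ * f).coeff j ∈ V := by
    rw [MvPolynomial.coeff_C_mul, ← V.valuation_le_one_iff, map_mul, map_inv₀]
    by_cases hj : j ∈ f.support
    · exact inv_mul_le_one_of_le₀ (hmax j hj) zero_le
    · simp [MvPolynomial.notMem_support_iff.1 hj]
  obtain ⟨F, hF⟩ : MvPolynomial.C (f.coeff m)⁻¹ * f ∈
      Set.range (MvPolynomial.map (σ := σ) (algebraMap V K)) := by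
    rw [MvPolynomial.mem_range_map_iff_coeffs_subset]
    intro c hc
    obtain ⟨j, -, rfl⟩ := MvPolynomial.mem_coeffs_iff.1 hc
    exact ⟨⟨_, hmem j⟩, rfl⟩
  refine ⟨f.coeff m, F, ha, ?_, fun h0 ↦ ?_⟩
  · rw [hF, ← mul_assoc, ← MvPolynomial.C_mul, mul_inv_cancel₀ ha, MvPolynomial.C_1, one_mul]
  · have h1 : F.coeff m = 1 := by
      apply FaithfulSMul.algebraMap_injective V K
      rw [← MvPolynomial.coeff_map, hF, MvPolynomial.coeff_C_mul, inv_mul_cancel₀ ha, map_one]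
    have := congrArg (MvPolynomial.coeff m) h0
    rw [MvPolynomial.coeff_map, h1, map_one, MvPolynomial.coeff_zero] at this
    exact one_ne_zero this

lemma ValuationSubring.coeff_mul_coeff_mem {K σ : Type*} [Field K] (V : ValuationSubring K)
    {f g : MvPolynomial σ K} (h : ∀ m, (f * g).coeff m ∈ V) (i j : σ →₀ ℕ) :
    f.coeff i * g.coeff j ∈ V := by
  rcases eq_or_ne f 0 with rfl | hf
  · simp
  rcases eq_or_ne g 0 with rfl | hg
  · simp
  obtain ⟨a, F, ha, rfl, hF⟩ := V.exists_primitive hf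
  obtain ⟨b, G, hb, rfl, hG⟩ := V.exists_primitive hg
  obtain ⟨m, hm⟩ := MvPolynomial.ne_zero_iff.1 (mul_ne_zero hF hG)
  rw [← map_mul, MvPolynomial.coeff_map, IsLocalRing.residue_ne_zero_iff_isUnit] at hm
  obtain ⟨u, hu⟩ := hm
  have hab : a * b ∈ V := by
    have hm := h m
    rw [mul_mul_mul_comm, ← MvPolynomial.C_mul, ← map_mul, MvPolynomial.coeff_C_mul,
      MvPolynomial.coeff_map, ← hu] at hm
    have := V.mul_mem _ _ hm (u⁻¹ : Vˣ).1.2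
    rwa [mul_assoc, show (algebraMap V K (u : V)) * ((u⁻¹ : Vˣ) : V) = 1 from
      congrArg Subtype.val u.mul_inv, mul_one] at this
  rw [MvPolynomial.coeff_C_mul, MvPolynomial.coeff_C_mul, mul_mul_mul_comm]
  rw [MvPolynomial.coeff_map, MvPolynomial.coeff_map]
  exact V.mul_mem _ _ hab (V.mul_mem _ _ (F.coeff i).2 (G.coeff j).2)

/-- The Dedekind Prague theorem: over a normal domain `R` with fraction field `K`, if `f * g` has
coefficients in `R`, then so do all products of a coefficient of `f` with a coefficient of `g`. -/
lemma isInteger_coeff_mul_coeff {R K σ : Type*} [CommRing R] [IsDomain R] [IsIntegrallyClosed R]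
    [Field K] [Algebra R K] [IsFractionRing R K] {f g : MvPolynomial σ K}
    (h : ∀ m, IsLocalization.IsInteger R ((f * g).coeff m)) (i j : σ →₀ ℕ) :
    IsLocalization.IsInteger R (f.coeff i * g.coeff j) := by
  have : IsIntegrallyClosedIn (algebraMap R K).range K := by
    rw [Subring.isIntegrallyClosedIn_iff]
    intro x hx
    obtain ⟨r, hr⟩ := IsIntegrallyClosed.isIntegral_iff (R := R) (K := K) (x := x) |>.1 <| by
      let := (algebraMap R K).rangeRestrict.toAlgebra
      have : IsScalarTower R (algebraMap R K).range K := .of_algebraMap_eq fun _ ↦ rfl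
      have : Algebra.IsIntegral R (algebraMap R K).range :=
        Algebra.isIntegral_of_surjective (algebraMap R K).rangeRestrict_surjective
      exact isIntegral_trans x hx
    exact ⟨r, hr⟩
  by_contra hcon
  obtain ⟨V, hV, hx⟩ := Subring.exists_le_valuationSubring_of_isIntegrallyClosedIn
    (R := (algebraMap R K).range) (x := f.coeff i * g.coeff j) hcon
  exact hx (V.coeff_mul_coeff_mem (fun m ↦ hV (h m)) i j)

/-- In a unique factorization domain, any finite set has a greatest common divisor, and it stays
one after passing to fractional multiples. -/
lemma UniqueFactorizationMonoid.exists_forall_dvd_forall_isInteger {T L ι : Type*} [CommRing T]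
    [IsDomain T] [UniqueFactorizationMonoid T] [Field L] [Algebra T L] [IsFractionRing T L]
    (s : Finset ι) (p : ι → T) :
    ∃ g : T, (∀ i ∈ s, g ∣ p i) ∧
      ∀ h : L, (∀ i ∈ s, IsLocalization.IsInteger T (h * algebraMap T L (p i))) →
        IsLocalization.IsInteger T (h * algebraMap T L g) := by
  classical
  have := Classical.arbitrary (NormalizedGCDMonoid T)
  refine ⟨s.gcd p, fun i hi ↦ Finset.gcd_dvd hi, fun h hh ↦ ?_⟩
  obtain ⟨a, b, hb, rfl⟩ := IsFractionRing.div_surjective (A := T) h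
  have hb0 : algebraMap T L b ≠ 0 :=
    IsFractionRing.to_map_ne_zero_of_mem_nonZeroDivisors hb
  have hdvd : b ∣ s.gcd fun i ↦ a * p i := by
    refine Finset.dvd_gcd fun i hi ↦ ?_
    obtain ⟨c, hc⟩ := hh i hi
    refine ⟨c, IsFractionRing.injective T L ?_⟩
    rw [map_mul, map_mul, hc]
    field_simp
  obtain ⟨c, hc⟩ := hdvd.trans (Finset.gcd_mul_left' s p a).dvd
  refine ⟨c, ?_⟩
  rw [div_mul_eq_mul_div, eq_div_iff hb0, ← map_mul, ← map_mul, hc, mul_comm]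

section Descent

attribute [local instance] MvPolynomial.algebraMvPolynomial

open TensorProduct

namespace MvPolynomial

variable {R K σ : Type*} [CommRing R] [Field K] [Algebra R K]

lemma isInteger_iff_forall_coeff {f : MvPolynomial σ K} :
    IsLocalization.IsInteger (MvPolynomial σ R) f ↔
      ∀ m, IsLocalization.IsInteger R (f.coeff m) := by
  constructor
  · rintro ⟨p, rfl⟩ m
    exact ⟨p.coeff m, by rw [algebraMap_def, coeff_map]⟩
  · intro h
    have : f ∈ Set.range (map (σ := σ) (algebraMap R K)) := by
      rw [mem_range_map_iff_coeffs_subset]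
      intro c hc
      obtain ⟨m, -, rfl⟩ := mem_coeffs_iff.1 hc
      exact h m
    exact this

/-- For a submodule `J` of `K`, the canonical embedding of `R[X] ⊗ J` in `K[X]`. -/
noncomputable def tensorSubmoduleHom (J : Submodule R K) :
    MvPolynomial σ R ⊗[R] J →ₗ[MvPolynomial σ R] MvPolynomial σ K :=
  (Algebra.TensorProduct.lift (Algebra.ofId (MvPolynomial σ R) (MvPolynomial σ K))
    (IsScalarTower.toAlgHom R K (MvPolynomial σ K)) fun _ _ ↦ .all _ _).toLinearMap ∘ₗ
    J.subtype.baseChange (MvPolynomial σ R)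

lemma tensorSubmoduleHom_tmul (J : Submodule R K) (p : MvPolynomial σ R) (c : J) :
    tensorSubmoduleHom J (p ⊗ₜ c) = map (algebraMap R K) p * C (c : K) := by
  simp only [tensorSubmoduleHom, LinearMap.comp_apply, LinearMap.baseChange_tmul,
    AlgHom.toLinearMap_apply, Algebra.TensorProduct.lift_tmul, Algebra.ofId_apply]
  rfl

lemma tensorSubmoduleHom_injective (J : Submodule R K) :
    Function.Injective (tensorSubmoduleHom (σ := σ) J) := by
  have h₁ : Function.Injective (J.subtype.baseChange (MvPolynomial σ R)) :=
    Module.Flat.lTensor_preserves_injective_linearMap _ J.injective_subtype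
  have h₂ : ∀ x, Algebra.TensorProduct.lift (Algebra.ofId (MvPolynomial σ R) (MvPolynomial σ K))
      (IsScalarTower.toAlgHom R K (MvPolynomial σ K)) (fun _ _ ↦ .all _ _) x =
      algebraTensorAlgEquiv R K (TensorProduct.comm R _ _ x) := by
    intro x
    induction x with
    | zero => simp
    | add x y hx hy => simp only [map_add, hx, hy]
    | tmul p c =>
      rw [Algebra.TensorProduct.lift_tmul, TensorProduct.comm_tmul, algebraTensorAlgEquiv_tmul,
        smul_eq_C_mul, mul_comm]
      rfl
  have h₃ := (algebraTensorAlgEquiv (σ := σ) R K).injective.comp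
    (TensorProduct.comm R (MvPolynomial σ R) K).injective
  intro x y hxy
  refine h₁ (h₃ ?_)
  simp only [Function.comp_apply, ← h₂]
  exact hxy

lemma mem_range_tensorSubmoduleHom {J : Submodule R K} {f : MvPolynomial σ K} :
    f ∈ LinearMap.range (tensorSubmoduleHom (σ := σ) J) ↔ ∀ m, f.coeff m ∈ J := by
  constructor
  · rintro ⟨x, rfl⟩ m
    induction x with
    | zero => simp
    | add x y hx hy =>
      rw [map_add, coeff_add]
      exact J.add_mem hx hy
    | tmul p c =>
      rw [tensorSubmoduleHom_tmul, mul_comm, coeff_C_mul, coeff_map, mul_comm, ← Algebra.smul_def]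
      exact J.smul_mem _ c.2
  · intro h
    rw [← f.support_sum_monomial_coeff]
    refine Submodule.sum_mem _ fun m _ ↦ ⟨monomial m 1 ⊗ₜ ⟨f.coeff m, h m⟩, ?_⟩
    rw [tensorSubmoduleHom_tmul, map_monomial, map_one, mul_comm, C_mul_monomial, mul_one]

end MvPolynomial

/-- A semidualizing ideal of a polynomial ring over a normal domain is extended from the base. -/
lemma IsSemidualizing.exists_submodule_equiv {R σ : Type} [CommRing R] [IsDomain R]
    [IsIntegrallyClosed R] [IsNoetherianRing (MvPolynomial σ R)]
    [IsIntegrallyClosed (MvPolynomial σ R)] {I : Ideal (MvPolynomial σ R)} (hI : I ≠ ⊥)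
    (h : IsSemidualizing (MvPolynomial σ R) I) :
    ∃ J : Submodule R (FractionRing R),
      Nonempty (I ≃ₗ[MvPolynomial σ R] MvPolynomial σ R ⊗[R] J) := by
  let K := FractionRing R
  let S := MvPolynomial σ R
  let T := MvPolynomial σ K
  let L := FractionRing S
  have hST : Function.Injective (algebraMap S T) :=
    MvPolynomial.map_injective _ (IsFractionRing.injective R K)
  have hM : (nonZeroDivisors R).map (MvPolynomial.C (σ := σ)) ≤ nonZeroDivisors S :=
    map_le_nonZeroDivisors_of_injective _ (MvPolynomial.C_injective σ R) le_rfl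
  let : Algebra T L := IsLocalization.localizationAlgebraOfSubmonoidLe T L _ _ hM
  have : IsScalarTower S T L := IsLocalization.localization_isScalarTower_of_submonoid_le T L _ _ hM
  have : IsFractionRing T L :=
    IsFractionRing.isFractionRing_of_isDomain_of_isLocalization
      ((nonZeroDivisors R).map (MvPolynomial.C (σ := σ))) T L
  have hTL : Function.Injective (algebraMap T L) := IsFractionRing.injective T L
  obtain ⟨s, hs⟩ := IsNoetherian.noetherian I
  obtain ⟨g, hg, hgh⟩ := UniqueFactorizationMonoid.exists_forall_dvd_forall_isInteger (L := L) s
    (algebraMap S T)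
  have hgI : ∀ i ∈ I, g ∣ algebraMap S T i := by
    have : I ≤ (Ideal.span {g}).comap (algebraMap S T) := by
      rw [← hs]
      exact Submodule.span_le.2 fun i hi ↦ Ideal.mem_span_singleton.2 (hg i hi)
    exact fun i hi ↦ Ideal.mem_span_singleton.1 (this hi)
  have hg0 : g ≠ 0 := by
    obtain ⟨i, hi, hi0⟩ := Submodule.exists_mem_ne_zero_of_ne_bot hI
    exact ne_zero_of_dvd_ne_zero ((map_ne_zero_iff _ hST).2 hi0) (hgI i hi)
  let J : Submodule R K :=
    { carrier := {c | ∀ y : L, (∀ i ∈ I, IsLocalization.IsInteger S (y * algebraMap S L i)) →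
        ∀ e : T, algebraMap T L e = y * algebraMap T L g →
          ∀ j, IsLocalization.IsInteger R (e.coeff j * c)}
      add_mem' := fun ha hb y hy e he j ↦ by
        rw [mul_add]
        exact IsLocalization.isInteger_add (ha y hy e he j) (hb y hy e he j)
      zero_mem' := fun y hy e he j ↦ by
        rw [mul_zero]
        exact ⟨0, map_zero _⟩
      smul_mem' := fun s a ha y hy e he j ↦ by
        rw [mul_smul_comm]
        exact IsLocalization.isInteger_smul (ha y hy e he j) }
  refine ⟨J, ?_⟩
  let Ψ : S ⊗[R] J →ₗ[S] T := LinearMap.mulLeft S g ∘ₗ MvPolynomial.tensorSubmoduleHom J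
  have hΨ : Function.Injective Ψ :=
    (mul_right_injective₀ hg0).comp (MvPolynomial.tensorSubmoduleHom_injective J)
  let ι : I →ₗ[S] T := Algebra.linearMap S T ∘ₗ I.subtype
  have hι : Function.Injective ι := hST.comp I.injective_subtype
  have hrange : LinearMap.range ι = LinearMap.range Ψ := by
    ext t
    constructor
    · rintro ⟨⟨i, hi⟩, rfl⟩
      obtain ⟨f, hf⟩ := hgI i hi
      obtain ⟨x, hx⟩ : f ∈ LinearMap.range (MvPolynomial.tensorSubmoduleHom J) := by
        refine MvPolynomial.mem_range_tensorSubmoduleHom.2 fun m y hy e he j ↦ ?_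
        refine isInteger_coeff_mul_coeff (MvPolynomial.isInteger_iff_forall_coeff.1 ?_) j m
        obtain ⟨p, hp⟩ := hy i hi
        refine ⟨p, hTL ?_⟩
        rw [← IsScalarTower.algebraMap_apply, hp, map_mul, he, mul_assoc, ← map_mul, ← hf,
          ← IsScalarTower.algebraMap_apply]
      refine ⟨x, ?_⟩
      change g * MvPolynomial.tensorSubmoduleHom J x = algebraMap S T i
      rw [hx, hf]
    · rintro ⟨x, rfl⟩
      set f := MvPolynomial.tensorSubmoduleHom J x with hfx
      have hf : ∀ m, f.coeff m ∈ J :=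
        MvPolynomial.mem_range_tensorSubmoduleHom.1 ⟨x, rfl⟩
      obtain ⟨i, hi, hiz⟩ := h.exists_mem_of_forall hI (z := algebraMap T L (g * f)) <| by
        intro y hy
        obtain ⟨e, he⟩ := hgh y fun i hi ↦ by
          obtain ⟨p, hp⟩ := hy i (hs ▸ Submodule.subset_span hi)
          refine ⟨algebraMap S T p, ?_⟩
          rw [← IsScalarTower.algebraMap_apply, ← IsScalarTower.algebraMap_apply, hp]
        obtain ⟨p, hp⟩ : IsLocalization.IsInteger S (e * f) := by
          refine MvPolynomial.isInteger_iff_forall_coeff.2 fun m ↦ ?_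
          classical rw [MvPolynomial.coeff_mul]
          exact sum_mem fun ab _ ↦ hf ab.2 y hy e he ab.1
        refine ⟨p, ?_⟩
        rw [IsScalarTower.algebraMap_apply S T L, hp, map_mul, map_mul, he, mul_assoc]
      refine ⟨⟨i, hi⟩, hTL ?_⟩
      change algebraMap T L (algebraMap S T i) = algebraMap T L (g * f)
      rw [← hiz, ← IsScalarTower.algebraMap_apply]
  exact ⟨LinearEquiv.ofInjective ι hι ≪≫ₗ LinearEquiv.ofEq _ _ hrange ≪≫ₗ
    (LinearEquiv.ofInjective Ψ hΨ).symm⟩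

end Descent

open TensorProduct in
/-- A module is determined up to isomorphism by its base change to a polynomial ring. -/
lemma nonempty_equiv_of_baseChange_mvPolynomial.{u} {R σ : Type*} {M N : Type u}
    [CommRing R] [AddCommGroup M] [Module R M] [AddCommGroup N] [Module R N]
    (e : MvPolynomial σ R ⊗[R] M ≃ₗ[MvPolynomial σ R] MvPolynomial σ R ⊗[R] N) :
    Nonempty (M ≃ₗ[R] N) := by
  let ε : MvPolynomial σ R →ₐ[R] R := MvPolynomial.aeval 0
  let := ε.toRingHom.toAlgebra
  have : IsScalarTower R (MvPolynomial σ R) R := .of_algebraMap_eq fun r ↦ (ε.commutes r).symm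
  let c (P : Type u) [AddCommGroup P] [Module R P] :
      R ⊗[MvPolynomial σ R] (MvPolynomial σ R ⊗[R] P) ≃ₗ[R] P :=
    AlgebraTensorModule.cancelBaseChange R (MvPolynomial σ R) R R P ≪≫ₗ TensorProduct.lid R P
  exact ⟨(c M).symm ≪≫ₗ AlgebraTensorModule.congr (.refl R R) e ≪≫ₗ c N⟩

/-- for a normal domain `R` and `S = R[X_1,...,X_n]`, base change `C ↦ C ⊗_R S`
induces a bijection on isomorphism classes of semidualizing modules. -/
theorem statement13
    (R : Type) [CommRing R] [IsDomain R] [IsNoetherianRing R] [IsIntegrallyClosed R]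
    (n : ℕ) :
    (∀ (C : Type) [AddCommGroup C] [Module R C], IsSemidualizing R C →
       IsSemidualizing (MvPolynomial (Fin n) R)
         (TensorProduct R (MvPolynomial (Fin n) R) C)) ∧
    (∀ (D : Type) [AddCommGroup D] [Module (MvPolynomial (Fin n) R) D],
       IsSemidualizing (MvPolynomial (Fin n) R) D →
       ∃ C : ModuleCat.{0} R, IsSemidualizing R ↥C ∧
         Nonempty (D ≃ₗ[MvPolynomial (Fin n) R]
           TensorProduct R (MvPolynomial (Fin n) R) ↥C)) ∧
    (∀ (C C' : Type) [AddCommGroup C] [Module R C] [AddCommGroup C'] [Module R C'],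
       IsSemidualizing R C → IsSemidualizing R C' →
       Nonempty ((TensorProduct R (MvPolynomial (Fin n) R) C)
         ≃ₗ[MvPolynomial (Fin n) R] (TensorProduct R (MvPolynomial (Fin n) R) C')) →
       Nonempty (C ≃ₗ[R] C')) := by
  refine ⟨fun C _ _ hC ↦ (isSemidualizing_baseChange_iff _ C).2 hC, fun D _ _ hD ↦ ?_,
    fun C C' _ _ _ _ _ _ ⟨e⟩ ↦ nonempty_equiv_of_baseChange_mvPolynomial e⟩
  have := isIntegrallyClosed_mvPolynomial_fin R n
  obtain ⟨I, hI, ⟨e⟩⟩ := hD.exists_ideal_equiv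
  obtain ⟨J, ⟨e'⟩⟩ := (hD.of_equiv e).exists_submodule_equiv hI
  exact ⟨ModuleCat.of R J, (isSemidualizing_baseChange_iff _ J).1 (hD.of_equiv (e ≪≫ₗ e')),
    ⟨e ≪≫ₗ e'⟩⟩
end

section
/- Let R and S be commutative Noetherian rings and let φ: R → S and ψ: S → R be ring homomorphisms of finite flat dimension such that ψ ∘ φ is the identity on R and the kernel of ψ is contained in the Jacobson radical of S. Then base change along φ and base change along ψ each induce bijections on isomorphism classes of semidualizing modules: every semidualizing S-module is isomorphic to C ⊗_R S for a semidualizing R-module C that is unique up to isomorphism, and every semidualizing R-module is isomorphic to C' ⊗_S R for a semidualizing S-module C' that is unique up to isomorphism. -/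
open CategoryTheory

/-- A ring homomorphism has finite flat dimension if its target, viewed as a module over
the source, has finite flat dimension (uniform vanishing of `Tor` in high degrees). -/
def RingHomFiniteFlatDimension {R S : Type} [CommRing R] [CommRing S] (φ : R →+* S) : Prop :=
  letI : Module R S := Module.compHom S φ
  ∃ n : ℕ, ∀ (N : ModuleCat.{0} R) (i : ℕ), n < i →
    Subsingleton (((Tor (ModuleCat.{0} R) i).obj (ModuleCat.of R S)).obj N)

namespace RetractSemidualizing

open TensorProduct

/-! ### Matrices acting on powers of a module -/

section MatrixAction

variable {R : Type} [CommRing R]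

/-- A matrix acts as a linear map between finite powers of any module. -/
def matAct {m n : ℕ} (A : Matrix (Fin m) (Fin n) R) (M : Type) [AddCommGroup M] [Module R M] :
    (Fin n → M) →ₗ[R] (Fin m → M) :=
  LinearMap.pi fun i => ∑ j, A i j • LinearMap.proj j

lemma matAct_apply {m n : ℕ} (A : Matrix (Fin m) (Fin n) R) (M : Type) [AddCommGroup M]
    [Module R M] (x : Fin n → M) (i : Fin m) : matAct A M x i = ∑ j, A i j • x j := by
  simp [matAct]

lemma matAct_matAct {m n p : ℕ} (A : Matrix (Fin m) (Fin n) R) (B : Matrix (Fin n) (Fin p) R)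
    (M : Type) [AddCommGroup M] [Module R M] (x : Fin p → M) :
    matAct A M (matAct B M x) = matAct (A * B) M x := by
  ext i
  simp only [matAct_apply, Matrix.mul_apply, Finset.smul_sum, Finset.sum_smul, mul_smul]
  exact Finset.sum_comm

lemma matAct_zero {m n : ℕ} (M : Type) [AddCommGroup M] [Module R M] (x : Fin n → M) :
    matAct (0 : Matrix (Fin m) (Fin n) R) M x = 0 := by
  ext i; simp [matAct_apply]

lemma matAct_map {m n : ℕ} (A : Matrix (Fin m) (Fin n) R) {M N : Type} [AddCommGroup M]
    [Module R M] [AddCommGroup N] [Module R N] (f : M →ₗ[R] N) (x : Fin n → M) :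
    matAct A N (fun j => f (x j)) = fun i => f (matAct A M x i) := by
  ext i
  simp [matAct_apply, map_sum]

lemma matAct_eq_mulVecLin {m n : ℕ} (A : Matrix (Fin m) (Fin n) R) :
    matAct A R = A.mulVecLin := by
  refine LinearMap.ext fun x => funext fun i => ?_
  simp [matAct_apply, Matrix.mulVec, dotProduct]

lemma matAct_single {m n : ℕ} (A : Matrix (Fin m) (Fin n) R) (j : Fin n) :
    matAct A R (Pi.single j 1) = fun i => A i j := by
  rw [matAct_eq_mulVecLin, Matrix.mulVecLin_apply, Matrix.mulVec_single_one]
  rfl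

lemma mul_eq_zero_of_exact {m n p : ℕ} {A : Matrix (Fin m) (Fin n) R}
    {B : Matrix (Fin n) (Fin p) R} (h : Function.Exact (matAct B R) (matAct A R)) : A * B = 0 := by
  ext i j
  have := h.apply_apply_eq_zero (Pi.single j 1)
  rw [matAct_matAct, matAct_single] at this
  exact congrFun this i

lemma mapPi_exact {ι : Type} {M N P : Type} [AddCommGroup M] [Module R M] [AddCommGroup N]
    [Module R N] [AddCommGroup P] [Module R P] {f : M →ₗ[R] N} {g : N →ₗ[R] P}
    (h : Function.Exact f g) (y : ι → N) (hy : ∀ i, g (y i) = 0) : ∃ x : ι → M, ∀ i, f (x i) = y i := by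
  choose x hx using fun i => (h (y i)).1 (hy i)
  exact ⟨x, hx⟩

/-- The `R`-linear map out of a finite free module given by a family of vectors. -/
abbrev comb {n : ℕ} {M : Type} [AddCommGroup M] [Module R M] (g : Fin n → M) :
    (Fin n → R) →ₗ[R] M := Fintype.linearCombination R g

/-- The matrices `D i` and the generators `g` present a free resolution of `C`. -/
structure IsRes {C : Type} [AddCommGroup C] [Module R C] (b : ℕ → ℕ)
    (D : ∀ i, Matrix (Fin (b i)) (Fin (b (i + 1))) R) (g : Fin (b 0) → C) : Prop where
  exact : ∀ i, Function.Exact (matAct (D (i + 1)) R) (matAct (D i) R)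
  exact_zero : Function.Exact (matAct (D 0) R) (comb (R := R) g)
  surj : Function.Surjective (comb (R := R) g)

lemma exists_matAct_of_finite {m : ℕ} (K : Submodule R (Fin m → R)) (hK : K.FG) :
    ∃ (n : ℕ) (A : Matrix (Fin m) (Fin n) R), LinearMap.range (matAct A R) = K := by
  obtain ⟨n, v, hv⟩ := Submodule.fg_iff_exists_fin_generating_family.1 hK
  refine ⟨n, Matrix.of fun i j => v j i, ?_⟩
  rw [matAct_eq_mulVecLin, Matrix.range_mulVecLin, ← hv]
  rfl

lemma exists_next [IsNoetherianRing R] (s : Σ m n : ℕ, Matrix (Fin m) (Fin n) R) :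
    ∃ (p : ℕ) (B : Matrix (Fin s.2.1) (Fin p) R),
      Function.Exact (matAct B R) (matAct s.2.2 R) := by
  obtain ⟨p, B, hB⟩ := exists_matAct_of_finite (LinearMap.ker (matAct s.2.2 R))
    (IsNoetherian.noetherian _)
  exact ⟨p, B, LinearMap.exact_iff.2 hB.symm⟩

/-- Any matrix over a Noetherian ring is the start of an exact sequence of matrices. -/
lemma exists_exact_extend [IsNoetherianRing R] (m n : ℕ) (A : Matrix (Fin m) (Fin n) R) :
    ∃ (b : ℕ → ℕ) (D : ∀ i, Matrix (Fin (b i)) (Fin (b (i + 1))) R) (h0 : b 0 = m)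
      (h1 : b 1 = n), (∀ i, Function.Exact (matAct (D (i + 1)) R) (matAct (D i) R)) ∧
      A = (D 0).submatrix (Fin.cast h0.symm) (Fin.cast h1.symm) := by
  choose p B hB using exists_next (R := R)
  let st : ℕ → Σ m n : ℕ, Matrix (Fin m) (Fin n) R :=
    fun i => Nat.rec ⟨m, n, A⟩ (fun _ s => ⟨s.2.1, p s, B s⟩) i
  exact ⟨fun i => (st i).1, fun i => (st i).2.2, rfl, rfl, fun i => hB (st i), rfl⟩

lemma exists_isRes [IsNoetherianRing R] (C : Type) [AddCommGroup C] [Module R C]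
    [Module.Finite R C] : ∃ (b : ℕ → ℕ) (D : ∀ i, Matrix (Fin (b i)) (Fin (b (i + 1))) R)
      (g : Fin (b 0) → C), IsRes b D g := by
  obtain ⟨m, g, hg⟩ := Module.Finite.exists_fin (R := R) (M := C)
  have hs : Function.Surjective (comb (R := R) g) := by
    rw [← LinearMap.range_eq_top, Fintype.range_linearCombination, hg]
  obtain ⟨n, A, hA⟩ := exists_matAct_of_finite (LinearMap.ker (comb (R := R) g))
    (IsNoetherian.noetherian _)
  obtain ⟨b, D, h0, h1, hD, hAD⟩ := exists_exact_extend m n A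
  subst h0 h1
  refine ⟨b, D, g, hD, ?_, hs⟩
  have : A = D 0 := hAD
  rw [← this]
  exact LinearMap.exact_iff.2 hA.symm

end MatrixAction

/-! ### Comparison with the derived functors -/

section DerivedFunctors

variable {R : Type} [CommRing R]

/-- The complex of finite free modules defined by a sequence of matrices. -/
noncomputable def resComplex (b : ℕ → ℕ) (D : ∀ i, Matrix (Fin (b i)) (Fin (b (i + 1))) R)
    (hD : ∀ i, Function.Exact (matAct (D (i + 1)) R) (matAct (D i) R)) :
    ChainComplex (ModuleCat.{0} R) ℕ :=
  ChainComplex.of (fun i => ModuleCat.of R (Fin (b i) → R))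
    (fun i => ModuleCat.ofHom (matAct (D i) R))
    (fun i => by ext1; exact (hD i).linearMap_comp_eq_zero)

lemma resComplex_d (b : ℕ → ℕ) (D : ∀ i, Matrix (Fin (b i)) (Fin (b (i + 1))) R)
    (hD : ∀ i, Function.Exact (matAct (D (i + 1)) R) (matAct (D i) R)) (i : ℕ) :
    (resComplex b D hD).d (i + 1) i = ModuleCat.ofHom (matAct (D i) R) :=
  ChainComplex.of_d (fun i => ModuleCat.of R (Fin (b i) → R))
    (fun i => ModuleCat.ofHom (matAct (D i) R)) i

lemma resComplex_exactAt_succ (b : ℕ → ℕ) (D : ∀ i, Matrix (Fin (b i)) (Fin (b (i + 1))) R)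
    (hD : ∀ i, Function.Exact (matAct (D (i + 1)) R) (matAct (D i) R)) (i : ℕ) :
    (resComplex b D hD).ExactAt (i + 1) := by
  rw [HomologicalComplex.exactAt_iff' _ (i + 2) (i + 1) i (by simp) (by simp),
    ShortComplex.ShortExact.moduleCat_exact_iff_function_exact]
  dsimp [HomologicalComplex.sc', HomologicalComplex.shortComplexFunctor']
  rw [resComplex_d, resComplex_d]
  exact hD i

/-- The projective resolution attached to an exact sequence of matrices. -/
noncomputable def projRes {C : Type} [AddCommGroup C] [Module R C] (b : ℕ → ℕ)
    (D : ∀ i, Matrix (Fin (b i)) (Fin (b (i + 1))) R) (g : Fin (b 0) → C) (h : IsRes b D g) :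
    ProjectiveResolution (ModuleCat.of R C) where
  complex := resComplex b D h.exact
  projective n := inferInstanceAs (Projective (ModuleCat.of R (Fin (b n) → R)))
  π := (ChainComplex.toSingle₀Equiv _ _).symm ⟨ModuleCat.ofHom (comb g), by
    rw [resComplex_d]; ext1; exact h.exact_zero.linearMap_comp_eq_zero⟩
  quasiIso := ⟨fun n => by
    cases n
    · rw [ChainComplex.quasiIsoAt₀_iff, ShortComplex.quasiIso_iff_of_zeros']
      · have h1 : (ShortComplex.mk (ModuleCat.ofHom (matAct (D 0) R)) (ModuleCat.ofHom (comb g))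
            (by ext1; exact h.exact_zero.linearMap_comp_eq_zero)).Exact :=
          (ShortComplex.ShortExact.moduleCat_exact_iff_function_exact _).2 h.exact_zero
        have h2 : Epi (ModuleCat.ofHom (comb (R := R) g)) :=
          (ModuleCat.epi_iff_surjective _).2 h.surj
        refine (ShortComplex.exact_and_epi_g_iff_of_iso ?_).2 ⟨h1, h2⟩
        exact ShortComplex.isoMk (Iso.refl _) (Iso.refl _) (Iso.refl _)
          (by
            dsimp [HomologicalComplex.shortComplexFunctor']
            rw [resComplex_d]
            exact (Category.id_comp _).trans (Category.comp_id _).symm)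
          (by
            refine (Category.id_comp _).trans (Eq.trans ?_ (Category.comp_id _).symm)
            exact (ChainComplex.toSingle₀Equiv_symm_apply_f_zero
              (C := resComplex b D h.exact) (ModuleCat.ofHom (comb g)) _).symm)
      all_goals rfl
    · rw [quasiIsoAt_iff_exactAt']
      · apply resComplex_exactAt_succ
      · apply ChainComplex.exactAt_succ_single_obj⟩

lemma exact_iff_of_linearEquiv {A₁ A₂ A₃ B₁ B₂ B₃ : Type} [AddCommGroup A₁] [AddCommGroup A₂]
    [AddCommGroup A₃] [AddCommGroup B₁] [AddCommGroup B₂] [AddCommGroup B₃] [Module R A₁]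
    [Module R A₂] [Module R A₃] [Module R B₁] [Module R B₂] [Module R B₃]
    {f : A₁ → A₂} {f' : A₂ → A₃} {g : B₁ → B₂} {g' : B₂ → B₃} (e₁ : A₁ ≃ₗ[R] B₁)
    (e₂ : A₂ ≃ₗ[R] B₂) (e₃ : A₃ ≃ₗ[R] B₃) (h : ∀ x, g (e₁ x) = e₂ (f x))
    (h' : ∀ x, g' (e₂ x) = e₃ (f' x)) : Function.Exact f f' ↔ Function.Exact g g' := by
  have key : ∀ x, (f' x = 0 ↔ g' (e₂ x) = 0) := fun x => by
    rw [h', e₃.map_eq_zero_iff]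
  have key2 : ∀ x, x ∈ Set.range f ↔ e₂ x ∈ Set.range g := fun x => by
    constructor
    · rintro ⟨y, rfl⟩; exact ⟨e₁ y, h y⟩
    · rintro ⟨y, hy⟩
      refine ⟨e₁.symm y, e₂.injective ?_⟩
      rw [← h, e₁.apply_symm_apply, hy]
  constructor
  · intro H y
    obtain ⟨x, rfl⟩ := e₂.surjective y
    rw [← key, ← key2]; exact H x
  · intro H x
    rw [key, key2]; exact H _

lemma piRing_comp_matAct {m n : ℕ} (A : Matrix (Fin m) (Fin n) R) (N : Type) [AddCommGroup N]
    [Module R N] (f : (Fin m → R) →ₗ[R] N) :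
    LinearEquiv.piRing R N (Fin n) R (f ∘ₗ matAct A R) =
      matAct A.transpose N (LinearEquiv.piRing R N (Fin m) R f) := by
  ext j
  rw [LinearEquiv.piRing_apply, LinearMap.comp_apply, matAct_single, matAct_apply,
    pi_eq_sum_univ' (fun i => A i j), map_sum]
  simp

lemma subsingleton_ext_iff {C : Type} [AddCommGroup C] [Module R C] {b : ℕ → ℕ}
    {D : ∀ i, Matrix (Fin (b i)) (Fin (b (i + 1))) R} {g : Fin (b 0) → C} (h : IsRes b D g)
    (N : Type) [AddCommGroup N] [Module R N] (i : ℕ) :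
    Subsingleton (ExtModule R (ModuleCat.of R C) (ModuleCat.of R N) (i + 1)) ↔
      Function.Exact (matAct (D i).transpose N) (matAct (D (i + 1)).transpose N) := by
  let P := projRes b D g h
  have e := P.isoExt (R := R) (i + 1) (ModuleCat.of R N)
  unfold ExtModule
  rw [← ModuleCat.isZero_iff_subsingleton, e.isZero_iff,
    ← HomologicalComplex.exactAt_iff_isZero_homology,
    HomologicalComplex.exactAt_iff' _ i (i + 1) (i + 2) (by simp) (by simp),
    ShortComplex.ShortExact.moduleCat_exact_iff_function_exact]
  let E : ∀ j, ((ModuleCat.of R (Fin (b j) → R)) ⟶ ModuleCat.of R N) ≃ₗ[R] (Fin (b j) → N) :=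
    fun j => (ModuleCat.homLinearEquiv (S := R)).trans (LinearEquiv.piRing R N (Fin (b j)) R)
  have comm : ∀ j (f : (ModuleCat.of R (Fin (b j) → R)) ⟶ ModuleCat.of R N),
      matAct (D j).transpose N (E j f) = E (j + 1) ((resComplex b D h.exact).d (j + 1) j ≫ f) := by
    intro j f
    rw [resComplex_d]
    exact (piRing_comp_matAct (D j) N f.hom).symm
  exact exact_iff_of_linearEquiv (E i) (E (i + 1)) (E (i + 2))
    (comm i) (comm (i + 1))

lemma matAct_piScalarRight {m n : ℕ} (A : Matrix (Fin m) (Fin n) R) (M : Type) [AddCommGroup M]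
    [Module R M] (x : M ⊗[R] (Fin n → R)) :
    matAct A M (TensorProduct.piScalarRight R R M (Fin n) x) =
      TensorProduct.piScalarRight R R M (Fin m) ((matAct A R).lTensor M x) := by
  suffices h : matAct A M ∘ₗ (TensorProduct.piScalarRight R R M (Fin n)).toLinearMap =
      (TensorProduct.piScalarRight R R M (Fin m)).toLinearMap ∘ₗ (matAct A R).lTensor M from
    LinearMap.congr_fun h x
  ext m k l
  simp only [LinearMap.coe_comp, Function.comp_apply, LinearEquiv.coe_coe,
    AlgebraTensorModule.curry_apply, curry_apply, LinearMap.restrictScalars_apply,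
    LinearMap.coe_single, piScalarRight_apply, LinearMap.lTensor_tmul, matAct_single,
    piScalarRightHom_tmul]
  simp [matAct_apply, Pi.single_apply, ite_smul]

lemma exact_of_subsingleton_tor {C : Type} [AddCommGroup C] [Module R C] {b : ℕ → ℕ}
    {D : ∀ i, Matrix (Fin (b i)) (Fin (b (i + 1))) R} {g : Fin (b 0) → C} (h : IsRes b D g)
    (M : Type) [AddCommGroup M] [Module R M] (i : ℕ)
    (hT : Subsingleton (((Tor (ModuleCat.{0} R) (i + 1)).obj (ModuleCat.of R M)).obj
      (ModuleCat.of R C))) :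
    Function.Exact (matAct (D (i + 1)) M) (matAct (D i) M) := by
  let P := projRes b D g h
  let F := (MonoidalCategory.tensoringLeft (ModuleCat.{0} R)).obj (ModuleCat.of R M)
  have e := P.isoLeftDerivedObj F (i + 1)
  have h0 : Limits.IsZero ((F.leftDerived (i + 1)).obj (ModuleCat.of R C)) :=
    ModuleCat.isZero_iff_subsingleton.2 hT
  have h1 := e.isZero_iff.1 h0
  change Limits.IsZero (HomologicalComplex.homology _ _) at h1
  rw [← HomologicalComplex.exactAt_iff_isZero_homology,
    HomologicalComplex.exactAt_iff' _ (i + 2) (i + 1) i (by simp) (by simp),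
    ShortComplex.ShortExact.moduleCat_exact_iff_function_exact] at h1
  let E : ∀ j, M ⊗[R] (Fin (b j) → R) ≃ₗ[R] (Fin (b j) → M) := fun j =>
    TensorProduct.piScalarRight R R M (Fin (b j))
  have comm : ∀ j (x : M ⊗[R] (Fin (b (j + 1)) → R)), matAct (D j) M (E (j + 1) x) =
      E j ((F.map ((resComplex b D h.exact).d (j + 1) j)).hom x) := by
    intro j x
    rw [resComplex_d]
    exact matAct_piScalarRight (D j) M x
  exact (exact_iff_of_linearEquiv (E (i + 2)) (E (i + 1)) (E i)
    (comm (i + 1)) (comm i)).1 h1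

end DerivedFunctors

/-! ### Finite flat dimension -/

section FlatDimension

variable {R : Type} [CommRing R]

lemma exact_matAct_of_flat {m n p : ℕ} {A : Matrix (Fin m) (Fin n) R}
    {B : Matrix (Fin n) (Fin p) R} (h : Function.Exact (matAct B R) (matAct A R))
    (M : Type) [AddCommGroup M] [Module R M] [Module.Flat R M] :
    Function.Exact (matAct B M) (matAct A M) :=
  (exact_iff_of_linearEquiv (TensorProduct.piScalarRight R R M (Fin p))
    (TensorProduct.piScalarRight R R M (Fin n))
    (TensorProduct.piScalarRight R R M (Fin m))
    (matAct_piScalarRight B M)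
    (matAct_piScalarRight A M)).1 (Module.Flat.lTensor_exact M h)

/-- Exact sequences of matrices stay exact from the `n`-th place on with coefficients in `M`. -/
def MatTorVanish (R : Type) [CommRing R] (n : ℕ) (M : Type) [AddCommGroup M] [Module R M] : Prop :=
  ∀ (b : ℕ → ℕ) (D : ∀ i, Matrix (Fin (b i)) (Fin (b (i + 1))) R),
    (∀ i, Function.Exact (matAct (D (i + 1)) R) (matAct (D i) R)) →
    ∀ i, n ≤ i → Function.Exact (matAct (D (i + 1)) M) (matAct (D i) M)

lemma MatTorVanish.succ {n : ℕ} {M : Type} [AddCommGroup M] [Module R M]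
    (h : MatTorVanish R n M) : MatTorVanish R (n + 1) M :=
  fun b D hD i hi => h b D hD i (by omega)

lemma matTorVanish_of_tor {n : ℕ} {M : Type} [AddCommGroup M] [Module R M]
    (h : ∀ (N : ModuleCat.{0} R) (i : ℕ), n < i →
      Subsingleton (((Tor (ModuleCat.{0} R) i).obj (ModuleCat.of R M)).obj N)) :
    MatTorVanish R n M := by
  intro b D hD i hi
  have hg : comb (R := R) (fun j => (LinearMap.range (matAct (D 0) R)).mkQ (Pi.single j 1)) =
      (LinearMap.range (matAct (D 0) R)).mkQ := by
    ext j
    simp [Fintype.linearCombination_apply, Pi.single_apply]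
  have hres : IsRes b D
      (fun j => (LinearMap.range (matAct (D 0) R)).mkQ (Pi.single j 1)) := by
    refine ⟨hD, ?_, ?_⟩
    · rw [hg, LinearMap.exact_iff, Submodule.ker_mkQ]
    · rw [hg]; exact Submodule.mkQ_surjective _
  exact exact_of_subsingleton_tor hres M i (h _ _ (by omega))

section ShortExact

variable {K G M : Type} [AddCommGroup K] [Module R K] [AddCommGroup G] [Module R G]
  [AddCommGroup M] [Module R M]

lemma MatTorVanish.ker {n : ℕ} (h : MatTorVanish R (n + 1) M) [Module.Flat R G]
    {f : K →ₗ[R] G} {p : G →ₗ[R] M} (hf : Function.Injective f) (he : Function.Exact f p)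
    (hp : Function.Surjective p) : MatTorVanish R n K := by
  intro b D hD i hi
  have hdd : ∀ (N : Type) [AddCommGroup N] [Module R N] j (x : Fin (b (j + 2)) → N),
      matAct (D j) N (matAct (D (j + 1)) N x) = 0 := fun N _ _ j x => by
    rw [matAct_matAct, mul_eq_zero_of_exact (hD j), matAct_zero]
  intro k
  constructor
  · intro hk
    obtain ⟨x, hx⟩ := (exact_matAct_of_flat (hD i) G (fun j => f (k j))).1 (by
      rw [matAct_map, hk]; ext; simp)
    obtain ⟨m, hm⟩ := (h b D hD (i + 1) (by omega) (fun j => p (x j))).1 (by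
      rw [matAct_map, hx]; ext j; simpa using he.apply_apply_eq_zero (k j))
    choose y hy using fun j => hp (m j)
    obtain ⟨k', hk'⟩ := mapPi_exact he (x - matAct (D (i + 2)) G y) (fun j => by
      rw [Pi.sub_apply, map_sub, ← congrFun hm j, sub_eq_zero, ← congrFun (matAct_map _ p y) j]
      simp [hy])
    refine ⟨k', ?_⟩
    ext j
    apply hf
    rw [← congrFun (matAct_map _ f k') j, ← congrFun hx j, funext hk', map_sub, hdd, sub_zero]
  · rintro ⟨x, rfl⟩; exact hdd K i x

end ShortExact

lemma MatTorVanish.flat [IsNoetherianRing R] {M : Type} [AddCommGroup M] [Module R M]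
    (h : MatTorVanish R 0 M) : Module.Flat R M := by
  rw [Module.Flat.iff_forall_isTrivialRelation]
  intro l a x hax
  obtain ⟨b, D, h0, h1, hD, hA⟩ := exists_exact_extend 1 l (Matrix.of fun _ j => a j)
  subst h1
  have hA' : ∀ i j, D 0 i j = a j := fun i j =>
    (congrFun (congrFun hA (Fin.cast h0 i)) j).symm
  obtain ⟨y, hy⟩ := (h b D hD 0 le_rfl x).1 (by ext i; simpa [matAct_apply, hA'] using hax)
  refine ⟨b 2, D 1, y, fun j => ?_, fun j => ?_⟩
  · rw [← hy, matAct_apply]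
  · have := congrFun (congrFun (mul_eq_zero_of_exact (hD 0)) (Fin.cast h0.symm 0)) j
    simpa [Matrix.mul_apply, hA'] using this

/-- `M` has flat dimension at most `n`, phrased through syzygies of arbitrary flat covers. -/
def FlatDimLE (R : Type) [CommRing R] : ℕ → ∀ (M : Type) [AddCommGroup M] [Module R M], Prop
  | 0, M, _, _ => Module.Flat R M
  | n + 1, M, _, _ => ∀ (K G : Type) [AddCommGroup K] [Module R K] [AddCommGroup G] [Module R G]
      (f : K →ₗ[R] G) (p : G →ₗ[R] M), Module.Flat R G → Function.Injective f →
      Function.Exact f p → Function.Surjective p → FlatDimLE R n K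

lemma MatTorVanish.flatDimLE [IsNoetherianRing R] {n : ℕ} : ∀ {M : Type} [AddCommGroup M]
    [Module R M], MatTorVanish R n M → FlatDimLE R n M := by
  induction n with
  | zero => intro M _ _ h; exact h.flat
  | succ n ih => intro M _ _ h K G _ _ _ _ f p _ hf he hp; exact ih (h.ker hf he hp)

end FlatDimension

/-! ### Semidualizing modules in terms of a free resolution -/

section Criterion

variable {R : Type} [CommRing R] {C : Type} [AddCommGroup C] [Module R C] {b : ℕ → ℕ}
  {D : ∀ i, Matrix (Fin (b i)) (Fin (b (i + 1))) R} {g : Fin (b 0) → C}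

lemma IsRes.sum_smul_eq_zero (h : IsRes b D g) (j : Fin (b 1)) : ∑ k, D 0 k j • g k = 0 := by
  have := h.exact_zero.apply_apply_eq_zero (Pi.single j 1)
  rwa [matAct_single, Fintype.linearCombination_apply] at this

lemma IsRes.matAct_transpose_map (h : IsRes b D g) {N : Type} [AddCommGroup N] [Module R N]
    (f : C →ₗ[R] N) : matAct (D 0).transpose N (fun k => f (g k)) = 0 := by
  rw [matAct_map]
  ext j
  rw [matAct_apply]
  simp only [Matrix.transpose_apply]
  rw [h.sum_smul_eq_zero, map_zero, Pi.zero_apply]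

lemma IsRes.exists_map (h : IsRes b D g) {N : Type} [AddCommGroup N] [Module R N]
    (x : Fin (b 0) → N) (hx : matAct (D 0).transpose N x = 0) :
    ∃ f : C →ₗ[R] N, ∀ k, f (g k) = x k := by
  have hle : LinearMap.ker (comb (R := R) g) ≤ LinearMap.ker (comb (R := R) x) := by
    rw [LinearMap.exact_iff.1 h.exact_zero]
    rintro _ ⟨y, rfl⟩
    rw [LinearMap.mem_ker]
    suffices hc : comb x ∘ₗ matAct (D 0) R = 0 from LinearMap.congr_fun hc y
    ext j
    have := congrFun hx j
    rw [matAct_apply] at this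
    simpa [matAct_single, Fintype.linearCombination_apply] using this
  refine ⟨(Submodule.liftQ _ _ hle) ∘ₗ
    (LinearMap.quotKerEquivOfSurjective _ h.surj).symm.toLinearMap, fun k => ?_⟩
  have : (LinearMap.quotKerEquivOfSurjective _ h.surj).symm (g k) =
      Submodule.Quotient.mk (Pi.single k 1) := by
    rw [LinearEquiv.symm_apply_eq, LinearMap.quotKerEquivOfSurjective_apply_mk]
    simp
  simp [this]

lemma IsRes.map_ext (h : IsRes b D g) {N : Type} [AddCommGroup N] [Module R N]
    {f f' : C →ₗ[R] N} (hf : ∀ k, f (g k) = f' (g k)) : f = f' := by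
  have : f ∘ₗ comb (R := R) g = f' ∘ₗ comb (R := R) g := by
    ext k; simpa using hf k
  exact LinearMap.ext fun c => by
    obtain ⟨y, rfl⟩ := h.surj c; exact LinearMap.congr_fun this y

/-- The dual of the resolution of `C`, with values in `M ⊗ C`, is a coresolution of `M`. -/
structure IsCores (b : ℕ → ℕ) (D : ∀ i, Matrix (Fin (b i)) (Fin (b (i + 1))) R)
    (M N : Type) [AddCommGroup M] [Module R M] [AddCommGroup N] [Module R N]
    (η : M →ₗ[R] (Fin (b 0) → N)) : Prop where
  inj : Function.Injective η
  exact_zero : Function.Exact η (matAct (D 0).transpose N)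
  exact_succ : ∀ i, Function.Exact (matAct (D i).transpose N) (matAct (D (i + 1)).transpose N)

/-- The map `r ↦ (r • g k)`. -/
def homothetyPi (R : Type) [CommRing R] {C : Type} [AddCommGroup C] [Module R C] {n : ℕ}
    (g : Fin n → C) : R →ₗ[R] (Fin n → C) :=
  LinearMap.pi fun k => LinearMap.toSpanSingleton R C (g k)

lemma homothetyPi_apply {n : ℕ} (g : Fin n → C) (r : R) (k : Fin n) :
    homothetyPi R g r k = r • g k := rfl

lemma isSemidualizing_iff (h : IsRes b D g) :
    IsSemidualizing R C ↔ IsCores b D R C (homothetyPi R g) := by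
  have hη : ∀ r, homothetyPi R g r = fun k => algebraMap R (Module.End R C) r (g k) :=
    fun r => rfl
  constructor
  · rintro ⟨_, hb, he⟩
    refine ⟨fun r s hrs => hb.1 (h.map_ext fun k => congrFun hrs k), fun x => ⟨fun hx => ?_, ?_⟩,
      fun i => (subsingleton_ext_iff h C i).1 (he (i + 1) (Nat.succ_pos i))⟩
    · obtain ⟨f, hf⟩ := h.exists_map x hx
      obtain ⟨r, rfl⟩ := hb.2 f
      exact ⟨r, funext hf⟩
    · rintro ⟨r, rfl⟩
      rw [hη]; exact h.matAct_transpose_map _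
  · intro hc
    refine ⟨Module.Finite.of_surjective _ h.surj, ⟨fun r s hrs => hc.inj ?_, fun f => ?_⟩,
      fun i hi => ?_⟩
    · rw [hη, hη, hrs]
    · obtain ⟨r, hr⟩ := (hc.exact_zero _).1 (h.matAct_transpose_map f)
      exact ⟨r, h.map_ext fun k => congrFun hr k⟩
    · obtain ⟨i, rfl⟩ := Nat.exists_eq_succ_of_ne_zero hi.ne'
      exact (subsingleton_ext_iff h C i).2 (hc.exact_succ i)

end Criterion

/-! ### Diagram chases -/

section Chase

variable {R : Type} [CommRing R]

/-- In a short exact sequence of complexes, exactness of the sub in degree `3` and of the middle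
in degree `2` gives exactness of the quotient in degree `2`. -/
lemma exact_quotient {K₂ K₃ K₄ G₁ G₂ G₃ G₄ M₁ M₂ M₃ : Type}
    [AddCommGroup K₂] [AddCommGroup K₃] [AddCommGroup K₄] [AddCommGroup G₁] [AddCommGroup G₂]
    [AddCommGroup G₃] [AddCommGroup G₄] [AddCommGroup M₁] [AddCommGroup M₂] [AddCommGroup M₃]
    [Module R K₂] [Module R K₃] [Module R K₄] [Module R G₁] [Module R G₂] [Module R G₃]
    [Module R G₄] [Module R M₁] [Module R M₂] [Module R M₃]
    {k₂ : K₂ →ₗ[R] K₃} {k₃ : K₃ →ₗ[R] K₄} {g₁ : G₁ →ₗ[R] G₂} {g₂ : G₂ →ₗ[R] G₃}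
    {g₃ : G₃ →ₗ[R] G₄} {m₁ : M₁ →ₗ[R] M₂} {m₂ : M₂ →ₗ[R] M₃}
    {i₂ : K₂ →ₗ[R] G₂} {i₃ : K₃ →ₗ[R] G₃} {i₄ : K₄ →ₗ[R] G₄}
    {p₁ : G₁ →ₗ[R] M₁} {p₂ : G₂ →ₗ[R] M₂} {p₃ : G₃ →ₗ[R] M₃}
    (hK : Function.Exact k₂ k₃) (hG : Function.Exact g₁ g₂) (hG' : ∀ x, g₃ (g₂ x) = 0)
    (hi₄ : Function.Injective i₄) (h₃ : Function.Exact i₃ p₃) (h₂ : ∀ x, p₂ (i₂ x) = 0)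
    (hp₂ : Function.Surjective p₂) (ci₂ : ∀ x, g₂ (i₂ x) = i₃ (k₂ x))
    (ci₃ : ∀ x, g₃ (i₃ x) = i₄ (k₃ x)) (cp₁ : ∀ x, p₂ (g₁ x) = m₁ (p₁ x))
    (cp₂ : ∀ x, p₃ (g₂ x) = m₂ (p₂ x)) (m : M₂) (hm : m₂ m = 0) : ∃ y : G₁, m₁ (p₁ y) = m := by
  obtain ⟨x, rfl⟩ := hp₂ m
  obtain ⟨k, hk⟩ := (h₃ (g₂ x)).1 (by rw [cp₂, hm])
  obtain ⟨k', rfl⟩ := (hK k).1 (hi₄ (by rw [← ci₃, hk, hG', map_zero]))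
  obtain ⟨y, hy⟩ := (hG (x - i₂ k')).1 (by rw [map_sub, ci₂, hk, sub_self])
  exact ⟨y, by rw [← cp₁, hy, map_sub, h₂, sub_zero]⟩

end Chase

/-! ### Semidualizing modules and modules of finite flat dimension -/

section TensorNice

variable {R : Type} [CommRing R] {C : Type} [AddCommGroup C] [Module R C]

lemma matAct_piRight {m n : ℕ} (A : Matrix (Fin m) (Fin n) R) (M : Type) [AddCommGroup M]
    [Module R M] (x : M ⊗[R] (Fin n → C)) :
    matAct A (M ⊗[R] C) (TensorProduct.piRight R R M (fun _ => C) x) =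
      TensorProduct.piRight R R M (fun _ => C) ((matAct A C).lTensor M x) := by
  induction x with
  | zero => simp
  | add x y hx hy => simp only [map_add, hx, hy]
  | tmul a c =>
    ext i
    simp [matAct_apply, TensorProduct.tmul_sum]

/-- The map `m ↦ (m ⊗ g k)`. -/
noncomputable def tmulPi (M : Type) [AddCommGroup M] [Module R M] {n : ℕ} (g : Fin n → C) :
    M →ₗ[R] (Fin n → M ⊗[R] C) :=
  LinearMap.pi fun k => (TensorProduct.mk R M C).flip (g k)

lemma tmulPi_apply {M : Type} [AddCommGroup M] [Module R M] {n : ℕ} (g : Fin n → C) (m : M)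
    (k : Fin n) : tmulPi M g m k = m ⊗ₜ[R] g k := rfl

/-- The map `(m k) ↦ ∑ m k ⊗ g k`. -/
noncomputable def tmulSum (M : Type) [AddCommGroup M] [Module R M] {n : ℕ} (g : Fin n → C) :
    (Fin n → M) →ₗ[R] M ⊗[R] C :=
  ∑ k, (TensorProduct.mk R M C).flip (g k) ∘ₗ LinearMap.proj k

lemma tmulSum_apply {M : Type} [AddCommGroup M] [Module R M] {n : ℕ} (g : Fin n → C)
    (m : Fin n → M) : tmulSum M g m = ∑ k, m k ⊗ₜ[R] g k := by
  simp [tmulSum]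

lemma lTensor_comb {M : Type} [AddCommGroup M] [Module R M] {n : ℕ} (g : Fin n → C)
    (x : M ⊗[R] (Fin n → R)) : (comb (R := R) g).lTensor M x =
      tmulSum M g (TensorProduct.piScalarRight R R M (Fin n) x) := by
  induction x with
  | zero => simp
  | add x y hx hy => simp [hx, hy]
  | tmul a c =>
    simp [tmulSum_apply, Fintype.linearCombination_apply, TensorProduct.tmul_sum,
      TensorProduct.smul_tmul]

variable {b : ℕ → ℕ} {D : ∀ i, Matrix (Fin (b i)) (Fin (b (i + 1))) R} {g : Fin (b 0) → C}

lemma IsRes.tmulSum_exact (h : IsRes b D g) (M : Type) [AddCommGroup M] [Module R M] :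
    Function.Exact (matAct (D 0) M) (tmulSum (R := R) M g) :=
  (exact_iff_of_linearEquiv (TensorProduct.piScalarRight R R M (Fin (b 1)))
    (TensorProduct.piScalarRight R R M (Fin (b 0))) (LinearEquiv.refl R (M ⊗[R] C))
    (matAct_piScalarRight (D 0) M) (fun x => (lTensor_comb (R := R) g x).symm)).1
    (lTensor_exact M h.exact_zero h.surj)

lemma IsRes.tmulSum_surjective (h : IsRes b D g) (M : Type) [AddCommGroup M] [Module R M] :
    Function.Surjective (tmulSum (R := R) M g) := by
  intro x
  obtain ⟨y, rfl⟩ := LinearMap.lTensor_surjective M h.surj x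
  exact ⟨_, (lTensor_comb (R := R) g y).symm⟩

/-- The resolution of `C` stays exact after tensoring with `M`, and its dual with values in
`M ⊗ C` is a coresolution of `M`. -/
structure Nice (b : ℕ → ℕ) (D : ∀ i, Matrix (Fin (b i)) (Fin (b (i + 1))) R)
    (g : Fin (b 0) → C) (M : Type) [AddCommGroup M] [Module R M] : Prop where
  exact : ∀ i, Function.Exact (matAct (D (i + 1)) M) (matAct (D i) M)
  cores : IsCores b D M (M ⊗[R] C) (tmulPi M g)

lemma nice_of_flat (h : IsRes b D g) (hc : IsCores b D R C (homothetyPi R g)) (M : Type)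
    [AddCommGroup M] [Module R M] [Module.Flat R M] : Nice b D g M := by
  have hη : ∀ x, tmulPi M g (TensorProduct.rid R M x) =
      TensorProduct.piRight R R M (fun _ => C) ((homothetyPi R g).lTensor M x) := by
    intro x
    induction x with
    | zero => simp
    | add x y hx hy => simp [hx, hy]
    | tmul a r => ext k; simp [tmulPi_apply, homothetyPi_apply, TensorProduct.smul_tmul]
  refine ⟨fun i => exact_matAct_of_flat (h.exact i) M, ?_, ?_, fun i => ?_⟩
  · have h1 := Module.Flat.lTensor_preserves_injective_linearMap (M := M) _ hc.inj
    intro x y hxy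
    obtain ⟨x, rfl⟩ := (TensorProduct.rid R M).surjective x
    obtain ⟨y, rfl⟩ := (TensorProduct.rid R M).surjective y
    rw [hη, hη] at hxy
    rw [h1 ((TensorProduct.piRight R R M (fun _ => C)).injective hxy)]
  · exact (exact_iff_of_linearEquiv (TensorProduct.rid R M)
      (TensorProduct.piRight R R M (fun _ => C))
      (TensorProduct.piRight R R M (fun _ => C)) hη
      (matAct_piRight _ M)).1 (Module.Flat.lTensor_exact M hc.exact_zero)
  · exact (exact_iff_of_linearEquiv (TensorProduct.piRight R R M (fun _ => C))
      (TensorProduct.piRight R R M (fun _ => C))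
      (TensorProduct.piRight R R M (fun _ => C)) (matAct_piRight _ M)
      (matAct_piRight _ M)).1 (Module.Flat.lTensor_exact M (hc.exact_succ i))

section ShortExact

variable {K G M : Type} [AddCommGroup K] [Module R K] [AddCommGroup G] [Module R G]
  [AddCommGroup M] [Module R M] {f : K →ₗ[R] G} {p : G →ₗ[R] M}

lemma tmulPi_map (g : Fin (b 0) → C) (f : K →ₗ[R] G) (x : K) :
    tmulPi G g (f x) = fun k => f.rTensor C (tmulPi K g x k) := by
  ext k; simp [tmulPi_apply]

lemma rTensor_injective_of_nice [IsNoetherianRing R] (h : IsRes b D g)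
    (hc : IsCores b D R C (homothetyPi R g)) (hK : Nice b D g K) (hG : Nice b D g G)
    (hf : Function.Injective f) : Function.Injective (f.rTensor C) := by
  have : Module.Finite R C := Module.Finite.of_surjective _ h.surj
  rw [← LinearMap.ker_eq_bot, LinearMap.ker_eq_bot']
  intro t ht
  let T := Submodule.span R {t}
  have hT : ∀ u ∈ T, f.rTensor C u = 0 := by
    intro u hu
    obtain ⟨r, rfl⟩ := Submodule.mem_span_singleton.1 hu
    rw [map_smul, ht, smul_zero]
  have hsub : Subsingleton (C →ₗ[R] T) := by
    refine ⟨fun a a' => ?_⟩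
    suffices hz : ∀ a : C →ₗ[R] T, a = 0 by rw [hz a, hz a']
    intro a
    obtain ⟨k, hk⟩ := (hK.cores.exact_zero _).1 (h.matAct_transpose_map (T.subtype ∘ₗ a))
    have hfk : f k = 0 := by
      apply hG.cores.inj
      rw [tmulPi_map, hk, map_zero]
      ext j
      exact hT _ (a (g j)).2
    have hk0 : k = 0 := hf (by rw [hfk, map_zero])
    refine h.map_ext fun j => Subtype.ext ?_
    have := congrFun hk j
    rw [hk0, map_zero] at this
    exact this.symm
  rw [IsSMulRegular.subsingleton_linearMap_iff] at hsub
  obtain ⟨r, hr, hreg⟩ := hsub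
  have hr0 : r = 0 := hc.inj (funext fun k => by
    rw [homothetyPi_apply, map_zero]; exact Module.mem_annihilator.1 hr _)
  subst hr0
  have := @hreg ⟨t, Submodule.mem_span_singleton_self t⟩ 0 (by simp)
  exact congrArg Subtype.val this

lemma compLeft_exact (he : Function.Exact f p) (n : ℕ) :
    Function.Exact (f.compLeft (Fin n)) (p.compLeft (Fin n)) := by
  intro y
  constructor
  · intro hy
    obtain ⟨x, hx⟩ := mapPi_exact he y (fun j => congrFun hy j)
    exact ⟨x, funext hx⟩
  · rintro ⟨x, rfl⟩
    exact funext fun j => he.apply_apply_eq_zero (x j)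

lemma compLeft_injective (hf : Function.Injective f) (n : ℕ) :
    Function.Injective (f.compLeft (Fin n)) := fun _ _ h => funext fun j => hf (congrFun h j)

lemma compLeft_surjective (hp : Function.Surjective p) (n : ℕ) :
    Function.Surjective (p.compLeft (Fin n)) := hp.comp_left

lemma matAct_compLeft {m n : ℕ} (A : Matrix (Fin m) (Fin n) R) (f : K →ₗ[R] G)
    (x : Fin n → K) : matAct A G (f.compLeft (Fin n) x) = f.compLeft (Fin m) (matAct A K x) :=
  matAct_map A f x

lemma matAct_transpose_matAct_transpose (h : IsRes b D g) (N : Type) [AddCommGroup N] [Module R N]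
    (i : ℕ) (x : Fin (b i) → N) :
    matAct (D (i + 1)).transpose N (matAct (D i).transpose N x) = 0 := by
  rw [matAct_matAct, ← Matrix.transpose_mul, mul_eq_zero_of_exact (h.exact i),
    Matrix.transpose_zero, matAct_zero]

lemma matAct_matAct_of_isRes (h : IsRes b D g) (N : Type) [AddCommGroup N] [Module R N]
    (i : ℕ) (x : Fin (b (i + 2)) → N) : matAct (D i) N (matAct (D (i + 1)) N x) = 0 := by
  rw [matAct_matAct, mul_eq_zero_of_exact (h.exact i), matAct_zero]

lemma matAct_transpose_tmulPi (h : IsRes b D g) (M : Type) [AddCommGroup M] [Module R M] (m : M) :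
    matAct (D 0).transpose (M ⊗[R] C) (tmulPi M g m) = 0 :=
  h.matAct_transpose_map (TensorProduct.mk R M C m)

lemma nice_of_shortExact (h : IsRes b D g)
    (hK : Nice b D g K) (hG : Nice b D g G)
    (hf : Function.Injective f) (he : Function.Exact f p) (hp : Function.Surjective p)
    (hinj : Function.Injective (f.rTensor C)) : Nice b D g M := by
  have heC : Function.Exact (f.rTensor C) (p.rTensor C) := rTensor_exact C he hp
  have hpC : Function.Surjective (p.rTensor C) := LinearMap.rTensor_surjective C hp
  have hz : ∀ x, p (f x) = 0 := he.apply_apply_eq_zero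
  have hzC : ∀ x, p.rTensor C (f.rTensor C x) = 0 := heC.apply_apply_eq_zero
  have hsum : ∀ {K G : Type} [AddCommGroup K] [Module R K] [AddCommGroup G] [Module R G]
      (f : K →ₗ[R] G) x, tmulSum G g (f.compLeft _ x) = f.rTensor C (tmulSum K g x) := by
    intro K G _ _ _ _ f x
    simp [tmulSum_apply]
  refine ⟨fun i m => ⟨fun hm => ?_, ?_⟩, fun x y hxy => ?_, fun m => ⟨fun hm => ?_, ?_⟩,
    fun i m => ⟨fun hm => ?_, ?_⟩⟩
  · cases i with
    | zero =>
      obtain ⟨y, hy⟩ := exact_quotient (h.tmulSum_exact K) (hG.exact 0)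
        (h.tmulSum_exact G).apply_apply_eq_zero hinj (compLeft_exact he _)
        (compLeft_exact he _).apply_apply_eq_zero (compLeft_surjective hp _)
        (matAct_compLeft _ f) (hsum f) (fun x => (matAct_compLeft _ p x).symm)
        (fun x => (matAct_compLeft _ p x).symm) m hm
      exact ⟨_, hy⟩
    | succ i =>
      obtain ⟨y, hy⟩ := exact_quotient (hK.exact i) (hG.exact (i + 1))
        (matAct_matAct_of_isRes h G i) (compLeft_injective hf _) (compLeft_exact he _)
        (compLeft_exact he _).apply_apply_eq_zero (compLeft_surjective hp _)
        (matAct_compLeft _ f) (matAct_compLeft _ f) (fun x => (matAct_compLeft _ p x).symm)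
        (fun x => (matAct_compLeft _ p x).symm) m hm
      exact ⟨_, hy⟩
  · rintro ⟨x, rfl⟩; exact matAct_matAct_of_isRes h M i x
  · obtain ⟨y, hy⟩ := exact_quotient (g₁ := (0 : PUnit →ₗ[R] G)) (m₁ := (0 : PUnit →ₗ[R] M))
      (p₁ := 0) hK.cores.exact_zero
      (fun z => ⟨fun hz => ⟨0, (hG.cores.inj (by rw [hz]; simp)).symm⟩, by rintro ⟨_, rfl⟩; simp⟩)
      (matAct_transpose_tmulPi h G) (compLeft_injective hinj _) (compLeft_exact heC _) hz hp
      (tmulPi_map g f) (matAct_compLeft _ _) (by simp) (fun x => (tmulPi_map g p x).symm) (x - y)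
      (by rw [map_sub, hxy, sub_self])
    exact (sub_eq_zero.1 hy.symm)
  · obtain ⟨y, hy⟩ := exact_quotient (hK.cores.exact_succ 0) hG.cores.exact_zero
      (matAct_transpose_matAct_transpose h _ 0) (compLeft_injective hinj _)
      (compLeft_exact heC _) (compLeft_exact heC _).apply_apply_eq_zero
      (compLeft_surjective hpC _) (matAct_compLeft _ _) (matAct_compLeft _ _)
      (fun x => (tmulPi_map g p x).symm) (fun x => (matAct_compLeft _ _ x).symm) m hm
    exact ⟨_, hy⟩
  · rintro ⟨x, rfl⟩; exact matAct_transpose_tmulPi h M x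
  · obtain ⟨y, hy⟩ := exact_quotient (hK.cores.exact_succ (i + 1)) (hG.cores.exact_succ i)
      (matAct_transpose_matAct_transpose h _ (i + 1)) (compLeft_injective hinj _)
      (compLeft_exact heC _) (compLeft_exact heC _).apply_apply_eq_zero
      (compLeft_surjective hpC _) (matAct_compLeft _ _) (matAct_compLeft _ _)
      (fun x => (matAct_compLeft _ _ x).symm) (fun x => (matAct_compLeft _ _ x).symm) m hm
    exact ⟨_, hy⟩
  · rintro ⟨x, rfl⟩; exact matAct_transpose_matAct_transpose h _ i x

end ShortExact

lemma FlatDimLE.nice [IsNoetherianRing R] (h : IsRes b D g)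
    (hc : IsCores b D R C (homothetyPi R g)) {n : ℕ} : ∀ {M : Type} [AddCommGroup M] [Module R M],
    FlatDimLE R n M → Nice b D g M := by
  induction n with
  | zero => intro M _ _ hM; have : Module.Flat R M := hM; exact nice_of_flat h hc M
  | succ n ih =>
    intro M _ _ hM
    let p : (M →₀ R) →ₗ[R] M := Finsupp.linearCombination R id
    have hp : Function.Surjective p := Finsupp.linearCombination_id_surjective R M
    have he : Function.Exact (LinearMap.ker p).subtype p := LinearMap.exact_subtype_ker_map p
    have hf : Function.Injective (LinearMap.ker p).subtype := Subtype.val_injective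
    have hK := ih (hM (LinearMap.ker p) (M →₀ R) (LinearMap.ker p).subtype p inferInstance hf he hp)
    have hG := nice_of_flat h hc (M →₀ R)
    exact nice_of_shortExact h hK hG hf he hp (rTensor_injective_of_nice h hc hK hG hf)

/-- Tensoring with `N` preserves the injectivity of syzygies of modules of finite flat
dimension. -/
def Good (R : Type) [CommRing R] (N : Type) [AddCommGroup N] [Module R N] : Prop :=
  ∀ (n : ℕ) (K G M : Type) [AddCommGroup K] [Module R K] [AddCommGroup G] [Module R G]
    [AddCommGroup M] [Module R M] (f : K →ₗ[R] G) (p : G →ₗ[R] M), FlatDimLE R (n + 1) M →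
    Module.Flat R G → Function.Injective f → Function.Exact f p → Function.Surjective p →
    Function.Injective (f.rTensor N)

lemma IsRes.good [IsNoetherianRing R] (h : IsRes b D g)
    (hc : IsCores b D R C (homothetyPi R g)) : Good R C := by
  intro n K G M _ _ _ _ _ _ f p hM hG hf he hp
  exact rTensor_injective_of_nice h hc ((hM K G f p hG hf he hp).nice h hc) (nice_of_flat h hc G) hf

end TensorNice

/-! ### Base change of semidualizing modules -/

section BaseChange

variable {R S : Type} [CommRing R] [CommRing S] [Algebra R S]

lemma matAct_algebraMap {m n : ℕ} (A : Matrix (Fin m) (Fin n) R) (N : Type) [AddCommGroup N]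
    [Module R N] [Module S N] [IsScalarTower R S N] :
    ⇑(matAct (A.map (algebraMap R S)) N) = matAct A N := by
  ext x i
  simp [matAct_apply]

lemma isSemidualizing_tensorProduct [IsNoetherianRing R] {n : ℕ} (hS : FlatDimLE R n S)
    {C : Type} [AddCommGroup C] [Module R C] (hC : IsSemidualizing R C) :
    IsSemidualizing S (S ⊗[R] C) := by
  have := hC.1
  obtain ⟨b, D, g, h⟩ := exists_isRes (R := R) C
  have hn := hS.nice h ((isSemidualizing_iff h).1 hC)
  have hcomb : ⇑(comb (R := S) fun k => (1 : S) ⊗ₜ[R] g k) = tmulSum (R := R) S g := by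
    ext x
    simp [tmulSum_apply, Fintype.linearCombination_apply, TensorProduct.smul_tmul']
  have hη : ⇑(homothetyPi S fun k => (1 : S) ⊗ₜ[R] g k) = tmulPi S g := by
    ext x k
    simp [tmulPi_apply, homothetyPi_apply, TensorProduct.smul_tmul']
  have hres : IsRes b (fun i => (D i).map (algebraMap R S)) (fun k => (1 : S) ⊗ₜ[R] g k) := by
    refine ⟨fun i => ?_, ?_, ?_⟩
    · rw [matAct_algebraMap, matAct_algebraMap]; exact hn.exact i
    · rw [matAct_algebraMap, hcomb]; exact h.tmulSum_exact S
    · rw [hcomb]; exact h.tmulSum_surjective S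
  rw [isSemidualizing_iff hres]
  refine ⟨?_, ?_, fun i => ?_⟩
  · rw [hη]; exact hn.cores.inj
  · rw [hη, ← Matrix.transpose_map, matAct_algebraMap]; exact hn.cores.exact_zero
  · rw [← Matrix.transpose_map, ← Matrix.transpose_map, matAct_algebraMap, matAct_algebraMap]
    exact hn.cores.exact_succ i

end BaseChange

lemma exists_matTorVanish {R S : Type} [CommRing R] [CommRing S] {φ : R →+* S}
    (hφ : RingHomFiniteFlatDimension φ) :
    letI := φ.toAlgebra
    ∃ n, MatTorVanish R n S := by
  let _ := φ.toAlgebra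
  obtain ⟨n, hn⟩ := hφ
  exact ⟨n, matTorVanish_of_tor (M := S) hn⟩

lemma isSemidualizing_extendScalars {R S : Type} [CommRing R] [CommRing S] [IsNoetherianRing R]
    {φ : R →+* S} (hφ : RingHomFiniteFlatDimension φ) (C : ModuleCat.{0} R)
    (hC : IsSemidualizing R C) : IsSemidualizing S ((ModuleCat.extendScalars φ).obj C) := by
  let _ := φ.toAlgebra
  obtain ⟨n, hn⟩ := exists_matTorVanish hφ
  exact isSemidualizing_tensorProduct hn.flatDimLE hC

/-! ### Modules over which finite flat dimension syzygies stay injective -/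

section GoodModules

variable {S : Type} [CommRing S]

lemma Good.pi {N : Type} [AddCommGroup N] [Module S N] (h : Good S N) (n : ℕ) :
    Good S (Fin n → N) := by
  intro m K G M _ _ _ _ _ _ f p hM hG hf he hp
  have key : ∀ x : K ⊗[S] (Fin n → N),
      TensorProduct.piRight S S G (fun _ => N) (f.rTensor (Fin n → N) x) =
        (f.rTensor N).compLeft (Fin n) (TensorProduct.piRight S S K (fun _ => N) x) := by
    intro x
    induction x with
    | zero => simp only [map_zero]
    | add x y hx hy => simp only [map_add, hx, hy]
    | tmul a c => ext i; simp
  intro x y hxy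
  apply (TensorProduct.piRight S S K (fun _ => N)).injective
  apply compLeft_injective (h m K G M f p hM hG hf he hp) n
  rw [← key, ← key, hxy]

lemma Good.prod {N N' : Type} [AddCommGroup N] [Module S N] [AddCommGroup N'] [Module S N']
    (h : Good S N) (h' : Good S N') : Good S (N × N') := by
  intro m K G M _ _ _ _ _ _ f p hM hG hf he hp
  have key : ∀ x : K ⊗[S] (N × N'),
      TensorProduct.prodRight S S G N N' (f.rTensor (N × N') x) =
        (f.rTensor N).prodMap (f.rTensor N') (TensorProduct.prodRight S S K N N' x) := by
    intro x
    induction x with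
    | zero => simp only [map_zero]
    | add x y hx hy => simp only [map_add, hx, hy]
    | tmul a c => simp
  intro x y hxy
  apply (TensorProduct.prodRight S S K N N').injective
  apply (Prod.map_injective.2 ⟨h m K G M f p hM hG hf he hp, h' m K G M f p hM hG hf he hp⟩)
  have := congrArg (TensorProduct.prodRight S S G N N') hxy
  rwa [key, key] at this

lemma Good.flat_tensor {N : Type} [AddCommGroup N] [Module S N] (h : Good S N) (F : Type)
    [AddCommGroup F] [Module S F] [Module.Flat S F] : Good S (F ⊗[S] N) := by
  intro m K G M _ _ _ _ _ _ f p hM hG hf he hp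
  have key : ∀ x : K ⊗[S] (F ⊗[S] N),
      TensorProduct.leftComm S G F N (f.rTensor (F ⊗[S] N) x) =
        (f.rTensor N).lTensor F (TensorProduct.leftComm S K F N x) := by
    intro x
    induction x with
    | zero => simp only [map_zero]
    | add x y hx hy => simp only [map_add, hx, hy]
    | tmul a c =>
      induction c with
      | zero => simp only [map_zero, TensorProduct.tmul_zero]
      | add x y hx hy => simp only [map_add, TensorProduct.tmul_add, hx, hy]
      | tmul b c => simp
  intro x y hxy
  apply (TensorProduct.leftComm S K F N).injective
  apply Module.Flat.lTensor_preserves_injective_linearMap (M := F) _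
    (h m K G M f p hM hG hf he hp)
  rw [← key, ← key, hxy]

end GoodModules

/-! ### Reduction modulo an ideal -/

section Reduction

variable {S : Type} [CommRing S] {Q : Type} [AddCommGroup Q] [Module S Q]

lemma mk_surjective {q : S →ₗ[S] Q} (hq : Function.Surjective q) (X : Type) [AddCommGroup X]
    [Module S X] : Function.Surjective (TensorProduct.mk S Q X (q 1)) := by
  intro t
  obtain ⟨u, rfl⟩ := LinearMap.rTensor_surjective X hq t
  obtain ⟨x, rfl⟩ := (TensorProduct.lid S X).symm.surjective u
  exact ⟨x, by simp⟩

/-- The multiplication map `J ⊗ X → X`. -/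
noncomputable def mulTensor (J : Ideal S) (X : Type) [AddCommGroup X] [Module S X] :
    J ⊗[S] X →ₗ[S] X := (TensorProduct.lid S X).toLinearMap ∘ₗ J.subtype.rTensor X

lemma mulTensor_tmul {J : Ideal S} {X : Type} [AddCommGroup X] [Module S X] (j : J) (x : X) :
    mulTensor J X (j ⊗ₜ x) = (j : S) • x := by
  simp [mulTensor]

lemma mulTensor_lTensor {J : Ideal S} {X Y : Type} [AddCommGroup X] [Module S X] [AddCommGroup Y]
    [Module S Y] (d : X →ₗ[S] Y) (w : J ⊗[S] X) :
    mulTensor J Y (d.lTensor J w) = d (mulTensor J X w) := by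
  induction w with
  | zero => simp only [map_zero]
  | add x y hx hy => simp only [map_add, hx, hy]
  | tmul a c => simp [mulTensor_tmul]

lemma range_mulTensor (J : Ideal S) (X : Type) [AddCommGroup X] [Module S X] :
    LinearMap.range (mulTensor J X) = J • (⊤ : Submodule S X) := by
  apply le_antisymm
  · rintro _ ⟨w, rfl⟩
    induction w with
    | zero => rw [map_zero]; exact zero_mem _
    | add x y hx hy => rw [map_add]; exact add_mem hx hy
    | tmul a c =>
      rw [mulTensor_tmul]
      exact Submodule.smul_mem_smul a.2 trivial
  · rw [Submodule.smul_le]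
    intro j hj x _
    exact ⟨⟨j, hj⟩ ⊗ₜ x, mulTensor_tmul _ _⟩

lemma mk_eq_zero_iff {q : S →ₗ[S] Q} (hq : Function.Surjective q) {X : Type} [AddCommGroup X]
    [Module S X] (x : X) :
    q 1 ⊗ₜ[S] x = 0 ↔ x ∈ LinearMap.ker q • (⊤ : Submodule S X) := by
  rw [← range_mulTensor]
  have he := rTensor_exact X (LinearMap.exact_subtype_ker_map q) hq ((TensorProduct.lid S X).symm x)
  rw [TensorProduct.lid_symm_apply, LinearMap.rTensor_tmul] at he
  rw [he]
  constructor
  · rintro ⟨w, hw⟩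
    refine ⟨w, ?_⟩
    change TensorProduct.lid S X (Submodule.subtype (LinearMap.ker q) |>.rTensor X w) = x
    rw [hw, TensorProduct.lid_tmul, one_smul]
  · rintro ⟨w, hw⟩
    refine ⟨w, (TensorProduct.lid S X).injective ?_⟩
    rw [TensorProduct.lid_tmul, one_smul]
    exact hw

lemma Good.mulTensor_injective {q : S →ₗ[S] Q} (hq : Function.Surjective q) {n : ℕ}
    (hQ : FlatDimLE S (n + 1) Q) {X : Type} [AddCommGroup X] [Module S X] (hX : Good S X) :
    Function.Injective (mulTensor (LinearMap.ker q) X) :=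
  (TensorProduct.lid S X).injective.comp (hX n _ S Q _ q hQ inferInstance Subtype.val_injective
    (LinearMap.exact_subtype_ker_map q) hq)

lemma map_mem_smul_top {J : Ideal S} {X Y : Type} [AddCommGroup X] [Module S X] [AddCommGroup Y]
    [Module S Y] (f : X →ₗ[S] Y) {x : X} (hx : x ∈ J • (⊤ : Submodule S X)) :
    f x ∈ J • (⊤ : Submodule S Y) :=
  Submodule.smul_mono le_rfl le_top (Submodule.map_smul'' J ⊤ f ▸ Submodule.mem_map_of_mem hx)

/-- Exactness of `X → Y → Z` modulo `J`, in terms of elements. -/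
def ExactMod (J : Ideal S) {X Y Z : Type} [AddCommGroup X] [Module S X] [AddCommGroup Y]
    [Module S Y] [AddCommGroup Z] [Module S Z] (d : X →ₗ[S] Y) (d' : Y →ₗ[S] Z) : Prop :=
  ∀ y, d' y ∈ J • (⊤ : Submodule S Z) → ∃ x, y - d x ∈ J • (⊤ : Submodule S Y)

lemma exactMod_of_exact_lTensor {q : S →ₗ[S] Q} (hq : Function.Surjective q) {X Y Z : Type}
    [AddCommGroup X] [Module S X] [AddCommGroup Y] [Module S Y] [AddCommGroup Z] [Module S Z]
    {d : X →ₗ[S] Y} {d' : Y →ₗ[S] Z} (h : Function.Exact (d.lTensor Q) (d'.lTensor Q)) :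
    ExactMod (LinearMap.ker q) d d' := by
  intro y hy
  rw [← mk_eq_zero_iff hq] at hy
  obtain ⟨t, ht⟩ := (h (q 1 ⊗ₜ y)).1 (by rw [LinearMap.lTensor_tmul, hy])
  obtain ⟨x, rfl⟩ := mk_surjective hq X t
  refine ⟨x, ?_⟩
  rw [← mk_eq_zero_iff hq, TensorProduct.tmul_sub, ← ht]
  simp

lemma exact_lTensor_of_exactMod {q : S →ₗ[S] Q} (hq : Function.Surjective q) {X Y Z : Type}
    [AddCommGroup X] [Module S X] [AddCommGroup Y] [Module S Y] [AddCommGroup Z] [Module S Z]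
    {d : X →ₗ[S] Y} {d' : Y →ₗ[S] Z} (hd : ∀ x, d' (d x) = 0)
    (h : ExactMod (LinearMap.ker q) d d') : Function.Exact (d.lTensor Q) (d'.lTensor Q) := by
  intro t
  constructor
  · intro ht
    obtain ⟨y, rfl⟩ := mk_surjective hq Y t
    obtain ⟨x, hx⟩ := h y ((mk_eq_zero_iff hq _).1 ht)
    rw [← mk_eq_zero_iff hq, TensorProduct.tmul_sub, sub_eq_zero] at hx
    exact ⟨q 1 ⊗ₜ x, hx.symm⟩
  · rintro ⟨u, rfl⟩
    obtain ⟨x, rfl⟩ := mk_surjective hq X u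
    simp [hd]

lemma ExactMod.flat_tensor {q : S →ₗ[S] Q} (hq : Function.Surjective q) {X Y Z : Type}
    [AddCommGroup X] [Module S X] [AddCommGroup Y] [Module S Y] [AddCommGroup Z] [Module S Z]
    {d : X →ₗ[S] Y} {d' : Y →ₗ[S] Z} (hd : ∀ x, d' (d x) = 0)
    (h : ExactMod (LinearMap.ker q) d d') (F : Type) [AddCommGroup F] [Module S F]
    [Module.Flat S F] : ExactMod (LinearMap.ker q) (d.lTensor F) (d'.lTensor F) := by
  apply exactMod_of_exact_lTensor hq
  have key : ∀ {X Y : Type} [AddCommGroup X] [Module S X] [AddCommGroup Y] [Module S Y]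
      (d : X →ₗ[S] Y) (x : F ⊗[S] (Q ⊗[S] X)),
      (d.lTensor F).lTensor Q (TensorProduct.leftComm S F Q X x) =
        TensorProduct.leftComm S F Q Y ((d.lTensor Q).lTensor F x) := by
    intro X Y _ _ _ _ d x
    induction x with
    | zero => simp only [map_zero]
    | add x y hx hy => simp only [map_add, hx, hy]
    | tmul a c =>
      induction c with
      | zero => simp only [map_zero, TensorProduct.tmul_zero]
      | add x y hx hy => simp only [map_add, TensorProduct.tmul_add, hx, hy]
      | tmul b c => simp
  exact (exact_iff_of_linearEquiv (TensorProduct.leftComm S F Q X)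
    (TensorProduct.leftComm S F Q Y) (TensorProduct.leftComm S F Q Z) (key d) (key d')).1
    (Module.Flat.lTensor_exact F (exact_lTensor_of_exactMod hq hd h))

lemma prod_mem_smul_top {J : Ideal S} {X Y : Type} [AddCommGroup X] [Module S X] [AddCommGroup Y]
    [Module S Y] {x : X} {y : Y} (hx : x ∈ J • (⊤ : Submodule S X))
    (hy : y ∈ J • (⊤ : Submodule S Y)) : (x, y) ∈ J • (⊤ : Submodule S (X × Y)) := by
  have := add_mem (map_mem_smul_top (LinearMap.inl S X Y) hx)
    (map_mem_smul_top (LinearMap.inr S X Y) hy)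
  simpa using this

lemma pi_mem_smul_top {J : Ideal S} {X : Type} [AddCommGroup X] [Module S X] {n : ℕ}
    {x : Fin n → X} (hx : ∀ i, x i ∈ J • (⊤ : Submodule S X)) :
    x ∈ J • (⊤ : Submodule S (Fin n → X)) := by
  have : x = ∑ i, LinearMap.single S (fun _ => X) i (x i) := by
    simpa using (Finset.univ_sum_single x).symm
  rw [this]
  exact sum_mem fun i _ => map_mem_smul_top _ (hx i)

end Reduction

/-! ### Complexes of good modules that are exact modulo an ideal -/

section Complexes

variable {S : Type} [CommRing S]

/-- A cochain complex of good modules which is exact modulo `J` in positive degrees. -/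
structure IsAcyc (J : Ideal S) (X : ℕ → ModuleCat.{0} S) (d : ∀ i, X i →ₗ[S] X (i + 1)) :
    Prop where
  good : ∀ i, Good S (X i)
  comp : ∀ i x, d (i + 1) (d i x) = 0
  exact : ∀ i, ExactMod J (d i) (d (i + 1))

/-- The complex `(Y, dY)` maps to `M ⊗ (X, d)` surjectively on cocycles. -/
def CoversTensor (M : Type) [AddCommGroup M] [Module S M] (X : ℕ → ModuleCat.{0} S)
    (d : ∀ i, X i →ₗ[S] X (i + 1)) (Y : ℕ → ModuleCat.{0} S)
    (dY : ∀ i, Y i →ₗ[S] Y (i + 1)) : Prop :=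
  ∃ φ : ∀ i, Y i →ₗ[S] M ⊗[S] X i, (∀ i y, φ (i + 1) (dY i y) = (d i).lTensor M (φ i y)) ∧
    ∀ i w, (d i).lTensor M w = 0 → ∃ y, dY i y = 0 ∧ φ i y = w

variable {Q : Type} [AddCommGroup Q] [Module S Q] {q : S →ₗ[S] Q}

lemma lTensor_lTensor_eq_zero (M : Type) [AddCommGroup M] [Module S M] {X Y Z : Type}
    [AddCommGroup X] [Module S X] [AddCommGroup Y] [Module S Y] [AddCommGroup Z] [Module S Z]
    {d : X →ₗ[S] Y} {d' : Y →ₗ[S] Z} (hd : ∀ x, d' (d x) = 0) (w : M ⊗[S] X) :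
    d'.lTensor M (d.lTensor M w) = 0 := by
  rw [← LinearMap.comp_apply, ← LinearMap.lTensor_comp,
    show d' ∘ₗ d = 0 from LinearMap.ext hd]
  simp

lemma rTensor_lTensor {K G X Y : Type} [AddCommGroup K] [Module S K] [AddCommGroup G] [Module S G]
    [AddCommGroup X] [Module S X] [AddCommGroup Y] [Module S Y] (f : K →ₗ[S] G) (d : X →ₗ[S] Y)
    (w : K ⊗[S] X) : f.rTensor Y (d.lTensor K w) = d.lTensor G (f.rTensor X w) := by
  rw [← LinearMap.comp_apply, ← LinearMap.comp_apply, LinearMap.rTensor_comp_lTensor,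
    LinearMap.lTensor_comp_rTensor]

lemma exists_coversTensor_of_shortExact (hq : Function.Surjective q) {K G M : Type}
    [AddCommGroup K] [Module S K] [AddCommGroup G] [Module S G] [AddCommGroup M] [Module S M]
    [Module.Flat S G] {f : K →ₗ[S] G} {p : G →ₗ[S] M} (he : Function.Exact f p)
    (hp : Function.Surjective p) {X Y : ℕ → ModuleCat.{0} S} {d : ∀ i, X i →ₗ[S] X (i + 1)}
    {dY : ∀ i, Y i →ₗ[S] Y (i + 1)} (hinj : ∀ i, Function.Injective (f.rTensor (X i)))
    (hX : IsAcyc (LinearMap.ker q) X d) (hY : IsAcyc (LinearMap.ker q) Y dY)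
    (hXY : CoversTensor K X d Y dY) :
    ∃ (Z : ℕ → ModuleCat.{0} S) (dZ : ∀ i, Z i →ₗ[S] Z (i + 1)),
      IsAcyc (LinearMap.ker q) Z dZ ∧ CoversTensor M X d Z dZ := by
  obtain ⟨φ, hφ, hφ'⟩ := hXY
  let ψ : ∀ i, Y i →ₗ[S] G ⊗[S] X i := fun i => f.rTensor (X i) ∘ₗ φ i
  have hψ : ∀ i y, ψ (i + 1) (dY i y) = (d i).lTensor G (ψ i y) := fun i y => by
    simp only [ψ, LinearMap.comp_apply, hφ, rTensor_lTensor]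
  have hpψ : ∀ i y, p.rTensor (X i) (ψ i y) = 0 := fun i y =>
    (rTensor_exact (X i) he hp).apply_apply_eq_zero (φ i y)
  let dG : ∀ i, G ⊗[S] X i →ₗ[S] G ⊗[S] X (i + 1) :=
    fun i => (d i).lTensor G
  have hdG : ∀ i x, dG (i + 1) (dG i x) = 0 := fun i => lTensor_lTensor_eq_zero _ (hX.comp i)
  have hψ2 : ∀ i y, ψ (i + 1) (dY i y) = dG i (ψ i y) := hψ
  let dZ : ∀ i, (Y (i + 1) × (G ⊗[S] X i)) →ₗ[S]
      (Y (i + 2) × (G ⊗[S] X (i + 1))) := fun i =>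
    LinearMap.prod (-(dY (i + 1) ∘ₗ LinearMap.fst S _ _))
      (ψ (i + 1) ∘ₗ LinearMap.fst S _ _ + dG i ∘ₗ LinearMap.snd S _ _)
  have hdZ : ∀ i y x, dZ i (y, x) = (-(dY (i + 1) y), ψ (i + 1) y + dG i x) := fun i y x => rfl
  refine ⟨fun i => ModuleCat.of S (Y (i + 1) × (G ⊗[S] X i)), dZ,
    ⟨fun i => (hY.good (i + 1)).prod ((hX.good i).flat_tensor G), ?_, ?_⟩,
    fun i => p.rTensor (X i) ∘ₗ LinearMap.snd S _ _, ?_, ?_⟩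
  · rintro i ⟨y, x⟩
    change dZ (i + 1) (dZ i (y, x)) = 0
    rw [hdZ, hdZ, Prod.mk_eq_zero]
    constructor
    · rw [map_neg, hY.comp, neg_zero, neg_zero]
    · rw [map_neg, map_add, hdG, hψ2, add_zero, neg_add_cancel]
  · rintro i ⟨y, x⟩ hyx
    change dZ (i + 1) (y, x) ∈ _ at hyx
    rw [hdZ] at hyx
    have h1 := map_mem_smul_top (LinearMap.fst S _ _) hyx
    have h2 := map_mem_smul_top (LinearMap.snd S _ _) hyx
    simp only [LinearMap.fst_apply, LinearMap.snd_apply] at h1 h2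
    obtain ⟨z, hz⟩ := hY.exact (i + 1) y (by simpa using h1)
    obtain ⟨z', hz'⟩ := (hX.exact i).flat_tensor hq (hX.comp i) G (x + ψ (i + 1) z) (by
      have h3 := sub_mem h2 (map_mem_smul_top (ψ (i + 2)) hz)
      rw [map_sub, hψ2] at h3
      change dG (i + 1) _ ∈ _
      rw [map_add]
      convert h3 using 1
      abel)
    refine ⟨(-z, z'), ?_⟩
    change (y, x) - dZ i (-z, z') ∈ _
    rw [hdZ, Prod.mk_sub_mk]
    apply prod_mem_smul_top
    · rw [map_neg, neg_neg]; exact hz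
    · rw [map_neg]
      convert hz' using 1
      change _ = _ - dG i z'
      abel
  · rintro i ⟨y, x⟩
    change p.rTensor (X (i + 1)) (ψ (i + 1) y + dG i x) = (d i).lTensor M (p.rTensor (X i) x)
    rw [map_add, hpψ, zero_add, rTensor_lTensor]
  · intro i w hw
    obtain ⟨x, rfl⟩ := LinearMap.rTensor_surjective (X i) hp w
    rw [← rTensor_lTensor] at hw
    obtain ⟨k, hk⟩ := (rTensor_exact (X (i + 1)) he hp _).1 hw
    obtain ⟨y, hy, rfl⟩ := hφ' (i + 1) k (by
      apply hinj (i + 2)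
      rw [rTensor_lTensor, hk, map_zero]
      exact hdG i x)
    refine ⟨(-y, x), ?_, rfl⟩
    change dZ i (-y, x) = 0
    rw [hdZ, Prod.mk_eq_zero, map_neg, hy, map_neg]
    refine ⟨by simp, ?_⟩
    change -f.rTensor (X (i + 1)) (φ (i + 1) y) + (d i).lTensor G x = 0
    rw [hk, neg_add_cancel]

lemma exists_coversTensor (hq : Function.Surjective q) {n : ℕ} : ∀ {M : Type} [AddCommGroup M]
    [Module S M], FlatDimLE S n M → ∀ {X : ℕ → ModuleCat.{0} S} {d : ∀ i, X i →ₗ[S] X (i + 1)},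
    IsAcyc (LinearMap.ker q) X d → ∃ (Y : ℕ → ModuleCat.{0} S) (dY : ∀ i, Y i →ₗ[S] Y (i + 1)),
      IsAcyc (LinearMap.ker q) Y dY ∧ CoversTensor M X d Y dY := by
  induction n with
  | zero =>
    intro M _ _ hM X d hX
    have : Module.Flat S M := hM
    refine ⟨fun i => ModuleCat.of S (M ⊗[S] X i), fun i => (d i).lTensor M,
      ⟨fun i => (hX.good i).flat_tensor M, fun i => lTensor_lTensor_eq_zero M (hX.comp i),
        fun i => (hX.exact i).flat_tensor hq (hX.comp i) M⟩, fun i => LinearMap.id,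
      fun i y => rfl, fun i w hw => ⟨w, hw, rfl⟩⟩
  | succ n ih =>
    intro M _ _ hM X d hX
    let p : (M →₀ S) →ₗ[S] M := Finsupp.linearCombination S id
    have hp : Function.Surjective p := Finsupp.linearCombination_id_surjective S M
    let f := (LinearMap.ker p).subtype
    have he : Function.Exact f p := LinearMap.exact_subtype_ker_map p
    have hf : Function.Injective f := Subtype.val_injective
    obtain ⟨Y, dY, hY, hXY⟩ := ih
      (hM (LinearMap.ker p) (M →₀ S) f p inferInstance hf he hp) hX
    exact exists_coversTensor_of_shortExact hq he hp
      (fun i => hX.good i n (LinearMap.ker p) (M →₀ S) M f p hM inferInstance hf he hp) hX hY hXY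

lemma exists_sub_mem_pow (hq : Function.Surjective q) {n : ℕ} (hQ : FlatDimLE S (n + 1) Q)
    (N : ℕ) : ∀ {X : ℕ → ModuleCat.{0} S} {d : ∀ i, X i →ₗ[S] X (i + 1)},
    IsAcyc (LinearMap.ker q) X d → ∀ i (x : X (i + 1)), d (i + 1) x = 0 →
    ∃ z : X i, x - d i z ∈ (LinearMap.ker q : Ideal S) ^ N • (⊤ : Submodule S (X (i + 1))) := by
  have hJ : FlatDimLE S n (LinearMap.ker q) := hQ _ S _ q inferInstance Subtype.val_injective
    (LinearMap.exact_subtype_ker_map q) hq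
  induction N with
  | zero => intro X d _ i x _; exact ⟨0, by simp⟩
  | succ N ih =>
    intro X d hX i x hx
    obtain ⟨Y, dY, hY, φ, hφ, hφ'⟩ := exists_coversTensor hq hJ hX
    obtain ⟨z, hz⟩ := hX.exact i x (by rw [hx]; exact zero_mem _)
    rw [← range_mulTensor] at hz
    obtain ⟨w, hw⟩ := hz
    obtain ⟨y, hy, rfl⟩ := hφ' (i + 1) w (by
      apply (hX.good (i + 2)).mulTensor_injective hq hQ
      rw [mulTensor_lTensor, hw, map_sub, hx, hX.comp, map_zero, sub_zero])
    obtain ⟨z', hz'⟩ := ih hY i y hy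
    refine ⟨z + mulTensor _ _ (φ i z'), ?_⟩
    have h1 := Submodule.mem_map_of_mem (f := mulTensor (LinearMap.ker q) _ ∘ₗ φ (i + 1)) hz'
    rw [Submodule.map_smul''] at h1
    rw [LinearMap.comp_apply, map_sub, map_sub, hw, hφ, mulTensor_lTensor] at h1
    rw [map_add, ← sub_sub, pow_succ, mul_smul, ← range_mulTensor]
    refine Submodule.smul_mono le_rfl ?_ h1
    rw [← LinearMap.range_eq_map]
    exact LinearMap.range_comp_le_range _ _

/-- A cocycle modulo `J` in degree `0` lifts to a cocycle. -/
lemma exists_cocycle_lift [IsNoetherianRing S] (hq : Function.Surjective q) {n : ℕ}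
    (hQ : FlatDimLE S (n + 1) Q) {X : ℕ → ModuleCat.{0} S} {d : ∀ i, X i →ₗ[S] X (i + 1)}
    (hX : IsAcyc (LinearMap.ker q) X d) [Module.Finite S (X 1)] (x : X 0)
    (hx : d 0 x ∈ (LinearMap.ker q : Ideal S) • (⊤ : Submodule S (X 1))) :
    ∃ y, d 0 y = 0 ∧ y - x ∈ (LinearMap.ker q : Ideal S) • (⊤ : Submodule S (X 0)) := by
  have hJ : FlatDimLE S n (LinearMap.ker q) := hQ _ S _ q inferInstance Subtype.val_injective
    (LinearMap.exact_subtype_ker_map q) hq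
  obtain ⟨Y, dY, hY, φ, hφ, hφ'⟩ := exists_coversTensor hq hJ hX
  obtain ⟨N, hN⟩ := Ideal.exists_pow_inf_eq_pow_smul (LinearMap.ker q : Ideal S)
    (LinearMap.range (d 0))
  rw [← range_mulTensor] at hx
  obtain ⟨w, hw⟩ := hx
  obtain ⟨y, hy, rfl⟩ := hφ' 1 w (by
    apply (hX.good 2).mulTensor_injective hq hQ
    rw [mulTensor_lTensor, hw, hX.comp, map_zero])
  obtain ⟨z', hz'⟩ := exists_sub_mem_pow hq hQ N hY 0 y hy
  have h1 := Submodule.mem_map_of_mem (f := mulTensor (LinearMap.ker q) _ ∘ₗ φ 1) hz'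
  rw [Submodule.map_smul''] at h1
  rw [LinearMap.comp_apply, map_sub, map_sub, hw, hφ, mulTensor_lTensor] at h1
  have h2 : d 0 (x - mulTensor _ _ (φ 0 z')) ∈
      (LinearMap.ker q : Ideal S) ^ (N + 1) • (⊤ : Submodule S (X 1)) := by
    rw [map_sub, pow_succ, mul_smul, ← range_mulTensor]
    refine Submodule.smul_mono le_rfl ?_ h1
    rw [← LinearMap.range_eq_map]
    exact LinearMap.range_comp_le_range _ _
  have h3 : d 0 (x - mulTensor _ _ (φ 0 z')) ∈
      (LinearMap.ker q : Ideal S) • LinearMap.range (d 0) := by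
    have h4 := hN (N + 1) (Nat.le_succ N)
    rw [Nat.add_sub_cancel_left, pow_one] at h4
    refine Submodule.smul_mono le_rfl inf_le_right (h4.le ⟨h2, ⟨_, rfl⟩⟩)
  rw [LinearMap.range_eq_map, ← Submodule.map_smul''] at h3
  obtain ⟨v, hv, hvd⟩ := h3
  refine ⟨x - mulTensor _ _ (φ 0 z') - v, by rw [map_sub, hvd, sub_self], ?_⟩
  have h5 : mulTensor (LinearMap.ker q) _ (φ 0 z') ∈
      (LinearMap.ker q : Ideal S) • (⊤ : Submodule S (X 0)) := by
    rw [← range_mulTensor]; exact ⟨_, rfl⟩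
  convert neg_mem (add_mem h5 hv) using 1
  abel

end Complexes

/-! ### Lifting isomorphisms along a quotient by an ideal in the Jacobson radical -/

section Lifting

variable {S : Type} [CommRing S] {Q : Type} [AddCommGroup Q] [Module S Q] {q : S →ₗ[S] Q}

lemma exists_lift [IsNoetherianRing S] (hq : Function.Surjective q) {n : ℕ}
    (hQ : FlatDimLE S (n + 1) Q) {C C' : Type} [AddCommGroup C] [Module S C] [AddCommGroup C']
    [Module S C'] {b : ℕ → ℕ} {D : ∀ i, Matrix (Fin (b i)) (Fin (b (i + 1))) S}
    {g : Fin (b 0) → C} (h : IsRes b D g) (hc : IsCores b D S C (homothetyPi S g))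
    [Module.Finite S C'] (hC' : Good S C') (e : Q ⊗[S] C ≃ₗ[S] Q ⊗[S] C') :
    ∃ f : C →ₗ[S] C', f.lTensor Q = e := by
  have hn := hQ.nice h hc
  let X : ℕ → ModuleCat.{0} S := fun i => ModuleCat.of S (Fin (b i) → C')
  let d : ∀ i, X i →ₗ[S] X (i + 1) := fun i => matAct (D i).transpose C'
  have hX : IsAcyc (LinearMap.ker q) X d := by
    refine ⟨fun i => hC'.pi (b i), fun i => matAct_transpose_matAct_transpose h C' i,
      fun i => exactMod_of_exact_lTensor hq ?_⟩
    refine (exact_iff_of_linearEquiv (TensorProduct.piRight S S Q (fun _ => C'))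
      (TensorProduct.piRight S S Q (fun _ => C')) (TensorProduct.piRight S S Q (fun _ => C'))
      (matAct_piRight _ Q) (matAct_piRight _ Q)).2 ?_
    exact (exact_iff_of_linearEquiv (LinearEquiv.piCongrRight fun _ => e)
      (LinearEquiv.piCongrRight fun _ => e) (LinearEquiv.piCongrRight fun _ => e)
      (fun x => matAct_map _ e.toLinearMap x) (fun x => matAct_map _ e.toLinearMap x)).1
      (hn.cores.exact_succ i)
  choose x hx using fun k => mk_surjective hq C' (e (q 1 ⊗ₜ g k))
  have : Module.Finite S (X 1) := inferInstanceAs (Module.Finite S (Fin (b 1) → C'))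
  obtain ⟨y, hy, hyx⟩ := exists_cocycle_lift hq hQ hX x (by
    apply pi_mem_smul_top
    intro j
    rw [← mk_eq_zero_iff hq]
    have h1 := congrFun (matAct_map (D 0).transpose (TensorProduct.mk S Q C' (q 1)) x) j
    rw [funext hx] at h1
    have h2 := h.matAct_transpose_map (e.toLinearMap ∘ₗ TensorProduct.mk S Q C (q 1))
    exact h1.symm.trans (congrFun h2 j))
  obtain ⟨f, hf⟩ := h.exists_map y hy
  have key : f.lTensor Q ∘ₗ TensorProduct.mk S Q C (q 1) =
      e.toLinearMap ∘ₗ TensorProduct.mk S Q C (q 1) := by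
    refine h.map_ext fun k => ?_
    have h1 := map_mem_smul_top (LinearMap.proj (φ := fun _ : Fin (b 0) => C') (R := S) k) hyx
    rw [← mk_eq_zero_iff hq] at h1
    have h2 : q 1 ⊗ₜ[S] (y k - x k) = 0 := h1
    rw [TensorProduct.tmul_sub, sub_eq_zero] at h2
    change q 1 ⊗ₜ f (g k) = e (q 1 ⊗ₜ g k)
    rw [hf, h2]
    exact hx k
  refine ⟨f, LinearMap.ext fun t => ?_⟩
  obtain ⟨c, rfl⟩ := mk_surjective hq C t
  exact LinearMap.congr_fun key c

lemma bijective_of_lTensor_bijective [IsNoetherianRing S] (hq : Function.Surjective q)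
    (hJ : LinearMap.ker q ≤ Ideal.jacobson (⊥ : Ideal S)) {n : ℕ}
    (hQ : FlatDimLE S (n + 1) Q) {C C' : Type} [AddCommGroup C] [Module S C] [AddCommGroup C']
    [Module S C'] [Module.Finite S C] [Module.Finite S C'] (hC' : Good S C') (f : C →ₗ[S] C')
    (hf : Function.Bijective (f.lTensor Q)) : Function.Bijective f := by
  have hsurj : Function.Surjective f := by
    rw [← LinearMap.range_eq_top, eq_top_iff]
    refine Submodule.le_of_le_smul_of_le_jacobson_bot Module.Finite.fg_top hJ ?_
    intro y _
    obtain ⟨t, ht⟩ := hf.2 (q 1 ⊗ₜ y)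
    obtain ⟨c, rfl⟩ := mk_surjective hq C t
    have h1 : y - f c ∈ LinearMap.ker q • (⊤ : Submodule S C') := by
      rw [← mk_eq_zero_iff hq, TensorProduct.tmul_sub, ← ht]
      simp
    rw [← add_sub_cancel (f c) y]
    exact Submodule.add_mem_sup ⟨c, rfl⟩ h1
  refine ⟨?_, hsurj⟩
  rw [← LinearMap.ker_eq_bot]
  refine Submodule.eq_bot_of_le_smul_of_le_jacobson_bot (LinearMap.ker q) _
    (IsNoetherian.noetherian _) ?_ hJ
  intro k hk
  have h1 : k ∈ LinearMap.ker q • (⊤ : Submodule S C) := by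
    rw [← mk_eq_zero_iff hq]
    apply hf.1
    rw [LinearMap.lTensor_tmul, LinearMap.mem_ker.1 hk, TensorProduct.tmul_zero, map_zero]
  rw [← range_mulTensor] at h1
  obtain ⟨w, rfl⟩ := h1
  have h2 : f.lTensor (LinearMap.ker q) w = 0 := by
    apply hC'.mulTensor_injective hq hQ
    rw [mulTensor_lTensor, LinearMap.mem_ker.1 hk, map_zero]
  obtain ⟨u, rfl⟩ := (lTensor_exact (LinearMap.ker q) (LinearMap.exact_subtype_ker_map f) hsurj
    w).1 h2
  rw [mulTensor_lTensor]
  have h3 : mulTensor (LinearMap.ker q) (LinearMap.ker f) u ∈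
      LinearMap.ker q • (⊤ : Submodule S (LinearMap.ker f)) := by
    rw [← range_mulTensor]; exact ⟨u, rfl⟩
  have h4 := Submodule.mem_map_of_mem (f := (LinearMap.ker f).subtype) h3
  rwa [Submodule.map_smul'', Submodule.map_subtype_top] at h4

lemma nonempty_linearEquiv_of_tensor [IsNoetherianRing S] (hq : Function.Surjective q)
    (hJ : LinearMap.ker q ≤ Ideal.jacobson (⊥ : Ideal S)) {n : ℕ}
    (hQ : FlatDimLE S (n + 1) Q) {C C' : Type} [AddCommGroup C] [Module S C] [AddCommGroup C']
    [Module S C'] (hC : IsSemidualizing S C) (hC' : IsSemidualizing S C')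
    (e : Q ⊗[S] C ≃ₗ[S] Q ⊗[S] C') : Nonempty (C ≃ₗ[S] C') := by
  have := hC.1
  have := hC'.1
  obtain ⟨b, D, g, h⟩ := exists_isRes (R := S) C
  obtain ⟨b', D', g', h'⟩ := exists_isRes (R := S) C'
  have hgood : Good S C' := h'.good ((isSemidualizing_iff h').1 hC')
  obtain ⟨f, hf⟩ := exists_lift hq hQ h ((isSemidualizing_iff h).1 hC) hgood e
  refine ⟨LinearEquiv.ofBijective f (bijective_of_lTensor_bijective hq hJ hQ hgood f ?_)⟩
  rw [hf]
  exact e.bijective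

end Lifting

lemma nonempty_iso_of_extendScalars {R S : Type} [CommRing R] [CommRing S] [IsNoetherianRing S]
    {ψ : S →+* R} (hψ : RingHomFiniteFlatDimension ψ) (hsurj : Function.Surjective ψ)
    (hker : RingHom.ker ψ ≤ Ideal.jacobson (⊥ : Ideal S)) {C C' : ModuleCat.{0} S}
    (hC : IsSemidualizing S C) (hC' : IsSemidualizing S C')
    (e : (ModuleCat.extendScalars ψ).obj C ≅ (ModuleCat.extendScalars ψ).obj C') :
    Nonempty (C ≅ C') := by
  let _ := ψ.toAlgebra
  obtain ⟨n, hn⟩ := exists_matTorVanish hψ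
  let e' : R ⊗[S] C ≃ₗ[R] R ⊗[S] C' := e.toLinearEquiv
  obtain ⟨E⟩ := nonempty_linearEquiv_of_tensor (q := Algebra.linearMap S R) hsurj
    (fun x hx => hker hx) hn.succ.flatDimLE hC hC' (e'.restrictScalars S)
  exact ⟨E.toModuleIso⟩

lemma nonempty_extendScalars_comp_iso {R S : Type} [CommRing R] [CommRing S] {φ : R →+* S}
    {ψ : S →+* R} (hcomp : ψ.comp φ = RingHom.id R) (C : ModuleCat.{0} R) :
    Nonempty ((ModuleCat.extendScalars ψ).obj ((ModuleCat.extendScalars φ).obj C) ≅ C) := by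
  have h : Nonempty ((ModuleCat.extendScalars (ψ.comp φ)).obj C ≅ C) := by
    rw [hcomp]
    exact ⟨(ModuleCat.extendScalarsId R).app C⟩
  exact h.map fun e => ((ModuleCat.extendScalarsComp φ ψ).app C).symm ≪≫ e

end RetractSemidualizing

/-- for a retract pair `φ : R → S`, `ψ : S → R` of finite flat dimension with
`ker ψ` in the Jacobson radical of `S`, base change along `φ` and along `ψ` induce bijections
on isomorphism classes of semidualizing modules. -/
theorem statement15
    (R S : Type) [CommRing R] [CommRing S] [IsNoetherianRing R] [IsNoetherianRing S]
    (φ : R →+* S) (ψ : S →+* R)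
    (hφ : RingHomFiniteFlatDimension φ) (hψ : RingHomFiniteFlatDimension ψ)
    (hcomp : ψ.comp φ = RingHom.id R)
    (hker : RingHom.ker ψ ≤ Ideal.jacobson (⊥ : Ideal S)) :
    (∀ C : ModuleCat.{0} R, IsSemidualizing R ↥C →
       IsSemidualizing S ↥((ModuleCat.extendScalars φ).obj C)) ∧
    (∀ D : ModuleCat.{0} S, IsSemidualizing S ↥D →
       ∃ C : ModuleCat.{0} R, IsSemidualizing R ↥C ∧
         Nonempty ((ModuleCat.extendScalars φ).obj C ≅ D)) ∧
    (∀ C C' : ModuleCat.{0} R, IsSemidualizing R ↥C → IsSemidualizing R ↥C' →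
       Nonempty ((ModuleCat.extendScalars φ).obj C ≅ (ModuleCat.extendScalars φ).obj C') →
       Nonempty (C ≅ C')) ∧
    (∀ C : ModuleCat.{0} S, IsSemidualizing S ↥C →
       IsSemidualizing R ↥((ModuleCat.extendScalars ψ).obj C)) ∧
    (∀ D : ModuleCat.{0} R, IsSemidualizing R ↥D →
       ∃ C : ModuleCat.{0} S, IsSemidualizing S ↥C ∧
         Nonempty ((ModuleCat.extendScalars ψ).obj C ≅ D)) ∧
    (∀ C C' : ModuleCat.{0} S, IsSemidualizing S ↥C → IsSemidualizing S ↥C' →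
       Nonempty ((ModuleCat.extendScalars ψ).obj C ≅ (ModuleCat.extendScalars ψ).obj C') →
       Nonempty (C ≅ C')) := by
  have hsurj : Function.Surjective ψ := fun r => ⟨φ r, RingHom.congr_fun hcomp r⟩
  have hRS := fun C hC => RetractSemidualizing.isSemidualizing_extendScalars hφ C hC
  have hSR := fun C hC => RetractSemidualizing.isSemidualizing_extendScalars hψ C hC
  have hiso := fun C => RetractSemidualizing.nonempty_extendScalars_comp_iso hcomp C
  refine ⟨hRS, fun D hD => ?_, fun C C' _ _ ⟨e⟩ => ?_, hSR, fun D hD => ?_,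
    fun C C' hC hC' ⟨e⟩ =>
      RetractSemidualizing.nonempty_iso_of_extendScalars hψ hsurj hker hC hC' e⟩
  · refine ⟨(ModuleCat.extendScalars ψ).obj D, hSR D hD, ?_⟩
    obtain ⟨e⟩ := hiso ((ModuleCat.extendScalars ψ).obj D)
    exact RetractSemidualizing.nonempty_iso_of_extendScalars hψ hsurj hker
      (hRS _ (hSR D hD)) hD e
  · obtain ⟨a⟩ := hiso C
    obtain ⟨a'⟩ := hiso C'
    exact ⟨a.symm ≪≫ (ModuleCat.extendScalars ψ).mapIso e ≪≫ a'⟩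
  · exact ⟨(ModuleCat.extendScalars φ).obj D, hRS D hD, hiso D⟩
end
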